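/- arXiv:1207.4856 — 2 statements merged into one kernel-verified Lean document; each statement's English description precedes it below -/
import Mathlib

section
/- For a Nakayama algebra, if X and Y are indecomposable non-projective Gorenstein projective modules and f : X → Y a homomorphism, then the kernel, image and cokernel of f are Gorenstein projective. -/
universe u

variable (Λ : Type u) [Ring Λ]

section BasicDefs

variable (M : Type u) [AddCommGroup M] [Module Λ M]

/-- A module is uniserial if its submodules are linearly ordered by inclusion. -/
def IsUniserialMod : Prop := ∀ N N' : Submodule Λ M, N ≤ N' ∨ N' ≤ N

/-- A module is indecomposable if it is nonzero and admits no nontrivial direct sum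
decomposition. -/
def IsIndecomposableMod : Prop :=
  Nontrivial M ∧ ∀ N N' : Submodule Λ M, IsCompl N N' → N = ⊥ ∨ N' = ⊥

/-- The radical of a module: the intersection of all maximal submodules. -/
def modRadical : Submodule Λ M := sInf {N : Submodule Λ M | IsCoatom N}

/-- The socle of a module: the sum of all simple submodules. -/
def modSocle : Submodule Λ M := sSup {N : Submodule Λ M | IsAtom N}

/-- `HasLength Λ M n` : the module `M` has a composition series of length `n`. -/
def HasLength (n : ℕ) : Prop :=
  ∃ c : Fin (n + 1) → Submodule Λ M,
    c 0 = ⊥ ∧ c (Fin.last n) = ⊤ ∧ ∀ i : Fin n, c i.castSucc ⋖ c i.succ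

end BasicDefs

/-- A Nakayama algebra: an artinian ring all of whose finite-length indecomposable
(left) modules are uniserial. -/
class IsNakayama : Prop where
  artinian : IsArtinianRing Λ
  serial : ∀ (M : Type u) [AddCommGroup M] [Module Λ M],
    (∃ n, HasLength Λ M n) → IsIndecomposableMod Λ M → IsUniserialMod Λ M

/-- `Λ` has no simple projective module. -/
def NoSimpleProjectives : Prop :=
  ∀ (M : Type u) [AddCommGroup M] [Module Λ M], IsSimpleModule Λ M → ¬ Module.Projective Λ M

/-- `Λ` is connected: no nontrivial central idempotents. -/
def IsConnectedAlg : Prop :=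
  ∀ e : Λ, IsIdempotentElem e → (∀ x : Λ, e * x = x * e) → e = 0 ∨ e = 1

section Covers

variable {Λ}
variable {P M : Type u} [AddCommGroup P] [Module Λ P] [AddCommGroup M] [Module Λ M]

/-- `p : P → M` is a projective cover: `P` projective, `p` surjective with superfluous
kernel. -/
structure IsProjCover (p : P →ₗ[Λ] M) : Prop where
  projective : Module.Projective Λ P
  surjective : Function.Surjective p
  superfluous : LinearMap.ker p ≤ modRadical Λ P

end Covers

/-- `S` is (isomorphic to) the top `M/rad M` of `M`, and is simple. -/
def IsTopOf (S M : Type u) [AddCommGroup S] [Module Λ S] [AddCommGroup M] [Module Λ M] :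
    Prop :=
  IsSimpleModule Λ S ∧
    ∃ p : M →ₗ[Λ] S, Function.Surjective p ∧ LinearMap.ker p = modRadical Λ M

/-- `S` is (isomorphic to) the socle of `M`. -/
def IsSocleOf (S M : Type u) [AddCommGroup S] [Module Λ S] [AddCommGroup M] [Module Λ M] :
    Prop :=
  ∃ i : S →ₗ[Λ] M, Function.Injective i ∧ LinearMap.range i = modSocle Λ M

/-- `IsTauOf Λ T S` : `T` is the Auslander–Reiten translate `τ S` of the simple module `S`;
for a Nakayama algebra without simple projectives this means there is a length-2 module
with top `S` and socle `T`. -/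
def IsTauOf (T S : Type u) [AddCommGroup T] [Module Λ T] [AddCommGroup S] [Module Λ S] :
    Prop :=
  IsSimpleModule Λ S ∧ IsSimpleModule Λ T ∧
    ∃ L : ModuleCat.{u} Λ, HasLength Λ L 2 ∧ IsTopOf Λ S L ∧ IsSocleOf Λ T L

/-- `GammaRel Λ S T` : `T = γ S = τ soc P(S)` in the resolution quiver. -/
def GammaRel (S T : Type u) [AddCommGroup S] [Module Λ S] [AddCommGroup T] [Module Λ T] :
    Prop :=
  IsSimpleModule Λ S ∧
    ∃ (P : ModuleCat.{u} Λ) (p : P →ₗ[Λ] S), IsProjCover p ∧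
      ∃ V : ModuleCat.{u} Λ, IsSimpleModule Λ V ∧ IsSocleOf Λ V P ∧ IsTauOf Λ T V

/-- A simple module is black if its projective dimension is at least 2, i.e. the kernel of
its projective cover is not projective. -/
def IsBlackSimple (S : Type u) [AddCommGroup S] [Module Λ S] : Prop :=
  IsSimpleModule Λ S ∧
    ∀ (P : ModuleCat.{u} Λ) (p : P →ₗ[Λ] S), IsProjCover p →
      ¬ Module.Projective Λ (LinearMap.ker p)

/-- A simple module is red if it has projective dimension exactly 1, i.e. the kernel of its
projective cover is projective. -/
def IsRedSimple (S : Type u) [AddCommGroup S] [Module Λ S] : Prop :=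
  IsSimpleModule Λ S ∧
    ∃ (P : ModuleCat.{u} Λ) (p : P →ₗ[Λ] S), IsProjCover p ∧
      Module.Projective Λ (LinearMap.ker p)

/-- A simple module is cyclically black if it lies on a cycle of the resolution quiver all
of whose vertices are black. -/
def IsCyclicallyBlack (S : Type u) [AddCommGroup S] [Module Λ S] : Prop :=
  ∃ (n : ℕ) (C : ℕ → ModuleCat.{u} Λ), 0 < n ∧
    Nonempty ((C 0 : Type u) ≃ₗ[Λ] S) ∧ Nonempty ((C n : Type u) ≃ₗ[Λ] S) ∧
    (∀ i < n, GammaRel Λ (C i) (C (i + 1))) ∧ ∀ i ≤ n, IsBlackSimple Λ (C i)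

/-- An indecomposable projective module is minimal projective if its radical is not
projective. -/
def IsMinimalProjective (P : Type u) [AddCommGroup P] [Module Λ P] : Prop :=
  Module.Projective Λ P ∧ IsIndecomposableMod Λ P ∧
    ¬ Module.Projective Λ (modRadical Λ P)

/-- `M` is Gorenstein projective: it is an image in a complete projective resolution, i.e.
an exact complex of projectives which stays exact after applying `Hom(-, Λ)`. -/
def IsGorensteinProjective (M : Type u) [AddCommGroup M] [Module Λ M] : Prop :=
  ∃ (P : ℤ → ModuleCat.{u} Λ) (d : ∀ i, P (i + 1) →ₗ[Λ] P i),
    (∀ i, Module.Projective Λ (P i)) ∧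
    (∀ i, Function.Exact (d (i + 1)) (d i)) ∧
    (∀ (i : ℤ) (φ : P (i + 1) →ₗ[Λ] Λ), φ.comp (d (i + 1)) = 0 →
      ∃ ψ : P i →ₗ[Λ] Λ, ψ.comp (d i) = φ) ∧
    Nonempty (M ≃ₗ[Λ] LinearMap.range (d 0))

/-- `M` has a finite projective resolution. -/
def HasFinitePD (M : Type u) [AddCommGroup M] [Module Λ M] : Prop :=
  ∃ (n : ℕ) (P : ℕ → ModuleCat.{u} Λ) (d : ∀ i, P (i + 1) →ₗ[Λ] P i)
      (ε : P 0 →ₗ[Λ] M),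
    (∀ i, Module.Projective Λ (P i)) ∧ Function.Surjective ε ∧
    Function.Exact (d 0) ε ∧ (∀ i, Function.Exact (d (i + 1)) (d i)) ∧
    ∀ i, n < i → Subsingleton (P i)

/-- `M` has injective dimension at most `n` (over the ring `Λ`). -/
def InjDimLE (M : Type u) [AddCommGroup M] [Module Λ M] (n : ℕ) : Prop :=
  ∃ (I : ℕ → ModuleCat.{u} Λ) (η : M →ₗ[Λ] I 0) (d : ∀ i, I i →ₗ[Λ] I (i + 1)),
    (∀ i, Module.Injective Λ (I i)) ∧ Function.Injective η ∧
    Function.Exact η (d 0) ∧ (∀ i, Function.Exact (d i) (d (i + 1))) ∧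
    ∀ i, n < i → Subsingleton (I i)

/-- `Λ` is a Gorenstein algebra: finite injective dimension as a left and right module
over itself. -/
def IsGorensteinAlg : Prop :=
  (∃ n, InjDimLE Λ Λ n) ∧ ∃ n, InjDimLE Λᵐᵒᵖ Λ n

/-- Every cycle of the resolution quiver consists of black vertices. -/
def AllCyclesBlack : Prop :=
  ∀ (n : ℕ) (C : ℕ → ModuleCat.{u} Λ), 0 < n →
    (∀ i < n, GammaRel Λ (C i) (C (i + 1))) →
    Nonempty ((C n : Type u) ≃ₗ[Λ] (C 0 : Type u)) →
    ∀ i ≤ n, IsBlackSimple Λ (C i)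

/-- Every cycle of the resolution quiver contains a red vertex. -/
def EveryCycleHasRed : Prop :=
  ∀ (n : ℕ) (C : ℕ → ModuleCat.{u} Λ), 0 < n →
    (∀ i < n, GammaRel Λ (C i) (C (i + 1))) →
    Nonempty ((C n : Type u) ≃ₗ[Λ] (C 0 : Type u)) →
    ∃ i ≤ n, IsRedSimple Λ (C i)

/-- `Λ` is CM-free: every finite-length Gorenstein projective module is projective. -/
def IsCMFree : Prop :=
  ∀ (M : Type u) [AddCommGroup M] [Module Λ M],
    (∃ n, HasLength Λ M n) → IsGorensteinProjective Λ M → Module.Projective Λ M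

/-- `Λ` has exactly `s` isomorphism classes of simple modules. -/
def SimpleCount (s : ℕ) : Prop :=
  ∃ F : Fin s → ModuleCat.{u} Λ,
    (∀ i, IsSimpleModule Λ (F i)) ∧
    (∀ i j, i ≠ j → IsEmpty ((F i : Type u) ≃ₗ[Λ] (F j : Type u))) ∧
    ∀ (S : Type u) [AddCommGroup S] [Module Λ S], IsSimpleModule Λ S →
      ∃ i, Nonempty (S ≃ₗ[Λ] (F i : Type u))

/-- Every (finite length) indecomposable projective module has length `> s`;
this is the condition `p > s`. -/
def MinProjLengthGT (s : ℕ) : Prop :=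
  ∀ (P : Type u) [AddCommGroup P] [Module Λ P],
    Module.Projective Λ P → IsIndecomposableMod Λ P →
      ∀ n, HasLength Λ P n → s < n

/-- An elementary Gorenstein projective module: nonzero, Gorenstein projective,
non-projective, and no proper nonzero factor module is Gorenstein projective. -/
def IsElementary (E : Type u) [AddCommGroup E] [Module Λ E] : Prop :=
  Nontrivial E ∧ (∃ n, HasLength Λ E n) ∧ IsGorensteinProjective Λ E ∧
    ¬ Module.Projective Λ E ∧
    ∀ N : Submodule Λ E, N ≠ ⊥ → N ≠ ⊤ → ¬ IsGorensteinProjective Λ (E ⧸ N)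

/-- `m` is the multiplicity of the simple module `S` as a composition factor of `M`. -/
def MultiplicityOf (S M : Type u) [AddCommGroup S] [Module Λ S] [AddCommGroup M]
    [Module Λ M] (m : ℕ) : Prop :=
  ∃ (n : ℕ) (c : Fin (n + 1) → Submodule Λ M),
    c 0 = ⊥ ∧ c (Fin.last n) = ⊤ ∧ (∀ i : Fin n, c i.castSucc ⋖ c i.succ) ∧
    m = Nat.card {i : Fin n //
      Nonempty ((↥(c i.succ) ⧸ (c i.castSucc).comap (c i.succ).subtype) ≃ₗ[Λ] S)}

/-- From `S`, the cycles of the resolution quiver can be reached (in a black-cycle vertex)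
in `m` steps. -/
def ReachesBlackIn (S : Type u) [AddCommGroup S] [Module Λ S] (m : ℕ) : Prop :=
  ∃ C : ℕ → ModuleCat.{u} Λ, Nonempty ((C 0 : Type u) ≃ₗ[Λ] S) ∧
    (∀ i < m, GammaRel Λ (C i) (C (i + 1))) ∧ IsCyclicallyBlack Λ (C m)

/-- `d` is the maximal distance of a vertex of the resolution quiver to the black cycles. -/
def MaxDistToBlack (d : ℕ) : Prop :=
  (∀ (S : Type u) [AddCommGroup S] [Module Λ S], IsSimpleModule Λ S →
      ∃ m ≤ d, ReachesBlackIn Λ S m) ∧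
  ∃ S : ModuleCat.{u} Λ, IsSimpleModule Λ S ∧ ∀ m < d, ¬ ReachesBlackIn Λ (S : Type u) m

section Aux

variable {Λ}

lemma aux_lift {A B C : Type u} [AddCommGroup A] [Module Λ A] [AddCommGroup B] [Module Λ B]
    [AddCommGroup C] [Module Λ C] (i : B →ₗ[Λ] C) (hi : Function.Injective i)
    (f : A →ₗ[Λ] C) (h : ∀ a, ∃ b, i b = f a) : ∃ g : A →ₗ[Λ] B, ∀ a, i (g a) = f a := by
  choose g hg using h
  refine ⟨{ toFun := g, map_add' := fun x y => hi ?_, map_smul' := fun r x => hi ?_ }, hg⟩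
  · simp [hg]
  · simp [hg]

lemma aux_desc {A B C : Type u} [AddCommGroup A] [Module Λ A] [AddCommGroup B] [Module Λ B]
    [AddCommGroup C] [Module Λ C] (p : A →ₗ[Λ] B) (hp : Function.Surjective p)
    (f : A →ₗ[Λ] C) (h : ∀ a, p a = 0 → f a = 0) : ∃ g : B →ₗ[Λ] C, ∀ a, g (p a) = f a := by
  have key : ∀ x y, p x = p y → f x = f y := fun x y hxy => by
    rw [← sub_eq_zero, ← map_sub]; apply h; rw [map_sub, hxy, sub_self]
  choose s hs using hp
  refine ⟨{ toFun := fun b => f (s b), map_add' := fun x y => ?_, map_smul' := fun r x => ?_ }, ?_⟩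
  · rw [← map_add]; apply key; simp [hs]
  · rw [RingHom.id_apply, ← map_smul]; apply key; simp [hs]
  · intro a; apply key; simp [hs]

lemma aux_projLift {P A B : Type u} [AddCommGroup P] [Module Λ P] [AddCommGroup A] [Module Λ A]
    [AddCommGroup B] [Module Λ B] (hP : Module.Projective Λ P) (p : A →ₗ[Λ] B)
    (hp : Function.Surjective p) (f : P →ₗ[Λ] B) : ∃ g : P →ₗ[Λ] A, ∀ x, p (g x) = f x := by
  obtain ⟨g, hg⟩ := Module.projective_lifting_property p f hp
  exact ⟨g, fun x => by rw [← hg]; rfl⟩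

/-- finitely generated uniserial -/
structure US (M : Type u) [AddCommGroup M] [Module Λ M] : Prop where
  fin : Module.Finite Λ M
  uni : IsUniserialMod Λ M

lemma US.of_surj {M N : Type u} [AddCommGroup M] [Module Λ M] [AddCommGroup N] [Module Λ N]
    (h : US (Λ := Λ) M) (p : M →ₗ[Λ] N) (hp : Function.Surjective p) : US (Λ := Λ) N := by
  have := h.fin
  refine ⟨Module.Finite.of_surjective p hp, fun A B => ?_⟩
  rcases h.uni (A.comap p) (B.comap p) with h | h
  · left; intro x hx; obtain ⟨y, rfl⟩ := hp x; exact h hx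
  · right; intro x hx; obtain ⟨y, rfl⟩ := hp x; exact h hx

lemma US.of_inj [IsArtinianRing Λ] {M N : Type u} [AddCommGroup M] [Module Λ M] [AddCommGroup N]
    [Module Λ N] (h : US (Λ := Λ) N) (p : M →ₗ[Λ] N) (hp : Function.Injective p) :
    US (Λ := Λ) M := by
  have := h.fin
  refine ⟨Module.Finite.of_injective p hp, fun A B => ?_⟩
  rcases h.uni (A.map p) (B.map p) with h | h
  · left; exact (Submodule.map_le_map_iff_of_injective hp _ _).1 h
  · right; exact (Submodule.map_le_map_iff_of_injective hp _ _).1 h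

lemma finite_of_hasLength {M : Type u} [AddCommGroup M] [Module Λ M]
    (h : ∃ n, HasLength Λ M n) : Module.Finite Λ M := by
  obtain ⟨n, c, h0, h1, h2⟩ := h
  have : IsFiniteLength Λ M := isFiniteLength_iff_exists_compositionSeries.2
    ⟨⟨n, c, h2⟩, h0, h1⟩
  rw [isFiniteLength_iff_isNoetherian_isArtinian] at this
  have := this.1
  infer_instance

lemma hasLength_of_finite [IsArtinianRing Λ] (M : Type u) [AddCommGroup M] [Module Λ M]
    [Module.Finite Λ M] : ∃ n, HasLength Λ M n := by
  have : IsFiniteLength Λ M := isFiniteLength_iff_isNoetherian_isArtinian.2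
    ⟨inferInstance, inferInstance⟩
  obtain ⟨s, h0, h1⟩ := isFiniteLength_iff_exists_compositionSeries.1 this
  exact ⟨s.length, s.toFun, h0, h1, s.step⟩

lemma us_of_indec [hN : IsNakayama Λ] (M : Type u) [AddCommGroup M] [Module Λ M]
    [Module.Finite Λ M] (h : IsIndecomposableMod Λ M) : US (Λ := Λ) M := by
  have := hN.artinian
  exact ⟨inferInstance, hN.serial M (hasLength_of_finite M) h⟩

/-- a nontrivial finite module has an element generating an atom -/
lemma exists_atom_elt [IsArtinianRing Λ] (M : Type u) [AddCommGroup M] [Module Λ M]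
    [Module.Finite Λ M] [Nontrivial M] :
    ∃ s : M, s ≠ 0 ∧ ∀ t : M, t ≠ 0 → t ∈ Submodule.span Λ {s} → s ∈ Submodule.span Λ {t} := by
  obtain ⟨a, ha, -⟩ := (IsAtomic.eq_bot_or_exists_atom_le (⊤ : Submodule Λ M)).resolve_left top_ne_bot
  obtain ⟨s, hs, hs0⟩ := Submodule.exists_mem_ne_zero_of_ne_bot ha.1
  have key : ∀ t, t ≠ 0 → t ∈ a → Submodule.span Λ {t} = a := fun t ht hta => by
    rcases ha.le_iff.1 ((Submodule.span_singleton_le_iff_mem t a).2 hta) with h | h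
    · simp at h; exact absurd h ht
    · exact h
  refine ⟨s, hs0, fun t ht hts => ?_⟩
  rw [key s hs0 hs] at hts
  rw [key t ht hts]; exact hs

/-- in a uniserial module, a map not killing an atom element is injective -/
lemma US.inj_of_atom {M N : Type u} [AddCommGroup M] [Module Λ M] [AddCommGroup N]
    [Module Λ N] (h : US (Λ := Λ) M) (s : M) (hs : s ≠ 0)
    (hat : ∀ t : M, t ≠ 0 → t ∈ Submodule.span Λ {s} → s ∈ Submodule.span Λ {t})
    (f : M →ₗ[Λ] N) (hf : f s ≠ 0) : Function.Injective f := by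
  rw [injective_iff_map_eq_zero]
  intro t ht
  by_contra ht0
  have key : s ∈ Submodule.span Λ {t} := by
    rcases h.uni (Submodule.span Λ {t}) (Submodule.span Λ {s}) with h | h
    · exact hat t ht0 (h (Submodule.mem_span_singleton_self t))
    · exact h (Submodule.mem_span_singleton_self s)
  obtain ⟨r, rfl⟩ := Submodule.mem_span_singleton.1 key
  exact hf (by simp [ht])

/-- amalgamation -/
lemma amalg [hN : IsNakayama Λ] {M P R : Type u} [AddCommGroup M] [Module Λ M] [AddCommGroup P]
    [Module Λ P] [AddCommGroup R] [Module Λ R] [Nontrivial M] (hP : US (Λ := Λ) P)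
    (hR : US (Λ := Λ) R) (i : M →ₗ[Λ] P) (hi : Function.Injective i) (g : M →ₗ[Λ] R)
    (hg : Function.Injective g) :
    (∃ h : P →ₗ[Λ] R, Function.Injective h ∧ ∀ m, h (i m) = g m) ∨
    (∃ h : R →ₗ[Λ] P, Function.Injective h ∧ ∀ m, h (g m) = i m) := by
  have := hN.artinian
  have := hP.fin
  have := hR.fin
  have := (hP.of_inj i hi).fin
  obtain ⟨s, hs0, hs⟩ := exists_atom_elt (Λ := Λ) M
  have atom_map : ∀ {T : Type u} [AddCommGroup T] [Module Λ T] (j : M →ₗ[Λ] T),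
      ∀ t : T, t ≠ 0 → t ∈ Submodule.span Λ {j s} → j s ∈ Submodule.span Λ {t} := by
    intro T _ _ j t ht htm
    obtain ⟨r, rfl⟩ := Submodule.mem_span_singleton.1 htm
    have h1 : s ∈ Submodule.span Λ {r • s} := hs _ (fun h => ht (by rw [← map_smul, h, map_zero]))
      (Submodule.mem_span_singleton.2 ⟨r, rfl⟩)
    obtain ⟨r', hr'⟩ := Submodule.mem_span_singleton.1 h1
    exact Submodule.mem_span_singleton.2 ⟨r', by rw [← map_smul, ← map_smul, hr']⟩
  let D : Submodule Λ (P × R) := LinearMap.range (i.prod (-g))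
  have hD : (i s, (0 : R)) ∉ D := by
    rintro ⟨m, hm⟩
    simp only [LinearMap.prod_apply, Function.prod_apply, Prod.mk.injEq, LinearMap.neg_apply, neg_eq_zero] at hm
    have : m = 0 := hg (by rw [hm.2, map_zero])
    subst this
    exact hs0 (hi (by rw [← hm.1]))
  obtain ⟨N, ⟨hDN, hsN⟩, hmax⟩ := WellFounded.has_min
    (wellFounded_gt : WellFounded (fun a b : Submodule Λ (P × R) => a > b))
    {N | D ≤ N ∧ (i s, (0 : R)) ∉ N} ⟨D, le_refl _, hD⟩
  have hbig : ∀ N' : Submodule Λ ((P × R) ⧸ N), N' ≠ ⊥ → N.mkQ (i s, 0) ∈ N' := by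
    intro N' hN'
    by_contra hc
    refine hmax (N'.comap N.mkQ) ⟨?_, hc⟩ ?_
    · refine hDN.trans ?_
      intro x hx
      have : N.mkQ x = 0 := by simpa using hx
      simp [this]
    · refine lt_of_le_of_ne ?_ ?_
      · intro x hx
        have : N.mkQ x = 0 := by simpa using hx
        simp [this]
      · intro he
        apply hN'
        rw [eq_bot_iff]
        intro y hy
        obtain ⟨x, rfl⟩ := N.mkQ_surjective y
        have : x ∈ N := by rw [he]; exact hy
        simpa using this
  have hne : N.mkQ (i s, 0) ≠ 0 := by simpa using hsN
  have hU : US (Λ := Λ) ((P × R) ⧸ N) := by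
    apply us_of_indec
    refine ⟨⟨⟨_, _, hne⟩⟩, fun A B hAB => ?_⟩
    by_contra hc
    push Not at hc
    exact hne (by simpa using hAB.disjoint.le_bot ⟨hbig A hc.1, hbig B hc.2⟩)
  let φ : P →ₗ[Λ] (P × R) ⧸ N := N.mkQ ∘ₗ LinearMap.inl Λ P R
  let ψ : R →ₗ[Λ] (P × R) ⧸ N := N.mkQ ∘ₗ LinearMap.inr Λ P R
  have hcomm : ∀ m, φ (i m) = ψ (g m) := by
    intro m
    rw [← sub_eq_zero]
    have : N.mkQ (i.prod (-g) m) = 0 := by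
      simpa using hDN ⟨m, rfl⟩
    rw [← this]
    simp only [φ, ψ, LinearMap.comp_apply, ← map_sub]
    congr 1
    simp
  have hφ : Function.Injective φ := hP.inj_of_atom (i s)
    (fun h => hs0 (hi (by rw [h, map_zero]))) (atom_map i) φ hne
  have hψ : Function.Injective ψ := hR.inj_of_atom (g s)
    (fun h => hs0 (hg (by rw [h, map_zero]))) (atom_map g) ψ (by rw [← hcomm]; exact hne)
  rcases hU.uni (LinearMap.range φ) (LinearMap.range ψ) with h | h
  · left
    obtain ⟨k, hk⟩ := aux_lift ψ hψ φ (fun a => h ⟨a, rfl⟩)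
    refine ⟨k, fun x y hxy => hφ (by rw [← hk, ← hk, hxy]), fun m => hψ (by rw [hk, hcomm])⟩
  · right
    obtain ⟨k, hk⟩ := aux_lift φ hφ ψ (fun a => h ⟨a, rfl⟩)
    refine ⟨k, fun x y hxy => hψ (by rw [← hk, ← hk, hxy]), fun m => hφ (by rw [hk, hcomm])⟩

/-- endomorphisms of `Λ` factoring over a f.g. uniserial projective -/
def UEnd : Set (Λ →ₗ[Λ] Λ) := {e | ∃ (R : Type u) (_ : AddCommGroup R) (_ : Module Λ R)
  (ι : R →ₗ[Λ] Λ) (π : Λ →ₗ[Λ] R), US (Λ := Λ) R ∧ Module.Projective Λ R ∧ e = ι ∘ₗ π}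

lemma comp_mem_closure [hN : IsNakayama Λ] (n : ℕ∞) : ∀ (F : Type u) [AddCommGroup F] [Module Λ F]
    [Module.Finite Λ F] [Module.Projective Λ F] (_ : Module.length Λ F = n)
    (ι : F →ₗ[Λ] Λ) (π : Λ →ₗ[Λ] F), ι ∘ₗ π ∈ AddSubmonoid.closure (UEnd (Λ := Λ)) := by
  have := hN.artinian
  induction n using WellFoundedLT.induction with
  | ind n ih =>
  intro F _ _ _ _ hF ι π
  by_cases hI : IsIndecomposableMod Λ F
  · exact AddSubmonoid.subset_closure ⟨F, _, _, ι, π, us_of_indec F hI, inferInstance, rfl⟩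
  rcases subsingleton_or_nontrivial F with hs | hnt
  · have : π = 0 := by ext; exact Subsingleton.elim _ _
    rw [this, LinearMap.comp_zero]; exact zero_mem _
  simp only [IsIndecomposableMod, hnt, true_and] at hI
  push Not at hI
  obtain ⟨A, B, hAB, hA, hB⟩ := hI
  have hA' : A ≠ ⊤ := fun h => hB (by have := hAB.disjoint; rw [h, top_disjoint] at this; exact this)
  have hB' : B ≠ ⊤ := fun h => hA (by have := hAB.disjoint; rw [h, disjoint_top] at this; exact this)
  have lt : ∀ C : Submodule Λ F, C ≠ ⊤ → Module.length Λ C < n := fun C hC => by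
    rw [← hF]; exact Submodule.length_lt hC
  have : Module.Projective Λ A := Module.Projective.of_split A.subtype
    (Submodule.projectionOnto A B hAB) (by ext; simp)
  have : Module.Projective Λ B := Module.Projective.of_split B.subtype
    (Submodule.projectionOnto B A hAB.symm) (by ext; simp)
  have h1 := ih _ (lt A hA') A rfl (ι ∘ₗ A.subtype) (Submodule.projectionOnto A B hAB ∘ₗ π)
  have h2 := ih _ (lt B hB') B rfl (ι ∘ₗ B.subtype) (Submodule.projectionOnto B A hAB.symm ∘ₗ π)
  convert add_mem h1 h2 using 1
  ext
  simp only [LinearMap.comp_apply, LinearMap.add_apply, ← map_add]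
  congr 1
  simp only [Submodule.subtype_apply]
  exact (Submodule.projection_add_projection_eq_self hAB _).symm

lemma id_mem_closure [hN : IsNakayama Λ] :
    (LinearMap.id : Λ →ₗ[Λ] Λ) ∈ AddSubmonoid.closure (UEnd (Λ := Λ)) :=
  comp_mem_closure (Λ := Λ) _ Λ rfl LinearMap.id LinearMap.id

/-- a f.g. uniserial module is cyclic -/
lemma US.cyclic {X : Type u} [AddCommGroup X] [Module Λ X] (h : US (Λ := Λ) X) [Nontrivial X] :
    ∃ (x : X) (J : Submodule Λ X), x ∉ J ∧ (∀ N : Submodule Λ X, N ≤ J ∨ N = ⊤) := by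
  have := h.fin
  obtain ⟨J, hJ, -⟩ := (eq_top_or_exists_le_coatom (⊥ : Submodule Λ X)).resolve_left bot_ne_top
  have : ∃ x, x ∉ J := by
    by_contra hc; push Not at hc
    exact hJ.1 (by rw [eq_top_iff]; intro x _; exact hc x)
  obtain ⟨x, hx⟩ := this
  refine ⟨x, J, hx, fun N => ?_⟩
  rcases h.uni N J with h | h
  · exact Or.inl h
  · rcases hJ.le_iff.1 h with h | h
    · exact Or.inr h
    · exact Or.inl h.le

lemma US.exists_surj {X : Type u} [AddCommGroup X] [Module Λ X] (h : US (Λ := Λ) X) :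
    ∃ c : Λ →ₗ[Λ] X, Function.Surjective c := by
  rcases subsingleton_or_nontrivial X with hs | hnt
  · exact ⟨0, fun x => ⟨0, Subsingleton.elim _ _⟩⟩
  obtain ⟨x, J, hx, hJ⟩ := h.cyclic
  refine ⟨LinearMap.toSpanSingleton Λ X x, ?_⟩
  rw [← LinearMap.range_eq_top]
  refine (hJ _).resolve_left (fun h => hx (h ⟨1, by simp⟩))

lemma US.cover [hN : IsNakayama Λ] {X : Type u} [AddCommGroup X] [Module Λ X]
    (h : US (Λ := Λ) X) [Nontrivial X] :
    ∃ (P : Type u) (_ : AddCommGroup P) (_ : Module Λ P) (p : P →ₗ[Λ] X),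
      US (Λ := Λ) P ∧ Module.Projective Λ P ∧ Function.Surjective p := by
  by_contra hc
  obtain ⟨x, J, hx, hJ⟩ := h.cyclic
  obtain ⟨c, hcs⟩ := h.exists_surj
  obtain ⟨l, rfl⟩ := hcs x
  apply hx
  have : ∀ e ∈ AddSubmonoid.closure (UEnd (Λ := Λ)), c (e l) ∈ J := by
    intro e he
    induction he using AddSubmonoid.closure_induction with
    | zero => simp
    | add e f _ _ h1 h2 => simpa using add_mem h1 h2
    | mem e he =>
      obtain ⟨R, _, _, ι, π, hR, hRp, rfl⟩ := he
      rcases hJ (LinearMap.range (c ∘ₗ ι)) with h | h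
      · exact h ⟨π l, rfl⟩
      · exact absurd ⟨R, _, _, c ∘ₗ ι, hR, hRp, LinearMap.range_eq_top.1 h⟩ hc
  exact this _ id_mem_closure

lemma US.embed [hN : IsNakayama Λ] {X F : Type u} [AddCommGroup X] [Module Λ X]
    [AddCommGroup F] [Module Λ F] (h : US (Λ := Λ) X) [Nontrivial X] (hF : Module.Projective Λ F)
    (j : X →ₗ[Λ] F) (hj : Function.Injective j) :
    ∃ (P : Type u) (_ : AddCommGroup P) (_ : Module Λ P) (p : X →ₗ[Λ] P),
      US (Λ := Λ) P ∧ Module.Projective Λ P ∧ Function.Injective p := by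
  have := hN.artinian
  have := h.fin
  obtain ⟨s, hs0, hs⟩ := exists_atom_elt (Λ := Λ) X
  obtain ⟨t, ht⟩ := Module.projective_def'.1 hF
  have hjs : t (j s) ≠ 0 := fun hh => by
    apply hs0; apply hj
    have := LinearMap.congr_fun ht (j s)
    rw [LinearMap.comp_apply, hh, map_zero] at this
    simpa using this.symm
  obtain ⟨k, hk⟩ := Finsupp.ne_iff.1 hjs
  let c : X →ₗ[Λ] Λ := Finsupp.lapply k ∘ₗ t ∘ₗ j
  have hc : c s ≠ 0 := hk
  by_contra hcon
  apply hc
  have : ∀ e ∈ AddSubmonoid.closure (UEnd (Λ := Λ)), e (c s) = 0 := by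
    intro e he
    induction he using AddSubmonoid.closure_induction with
    | zero => simp
    | add e f _ _ h1 h2 => simp [h1, h2]
    | mem e he =>
      obtain ⟨R, _, _, ι, π, hR, hRp, rfl⟩ := he
      by_contra hne
      refine hcon ⟨R, _, _, π ∘ₗ c, hR, hRp, h.inj_of_atom s hs0 hs _ (fun h => hne ?_)⟩
      rw [LinearMap.comp_apply] at h
      rw [LinearMap.comp_apply, h, map_zero]
  exact this _ id_mem_closure

/-- every map to `Λ` extends along `i` -/
def GoodMap {M P : Type u} [AddCommGroup M] [Module Λ M] [AddCommGroup P] [Module Λ P]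
    (i : M →ₗ[Λ] P) : Prop := ∀ g : M →ₗ[Λ] Λ, ∃ h : P →ₗ[Λ] Λ, ∀ m, h (i m) = g m

/-- no proper nonzero projective submodule -/
def BlackMod (P : Type u) [AddCommGroup P] [Module Λ P] : Prop :=
  ∀ R : Submodule Λ P, Module.Projective Λ R → R = ⊥ ∨ R = ⊤

lemma nontrivial_of_nonproj {M : Type u} [AddCommGroup M] [Module Λ M]
    (h : ¬ Module.Projective Λ M) : Nontrivial M := by
  rcases subsingleton_or_nontrivial M with hs | hnt
  · exact absurd (inferInstance : Module.Projective Λ M) h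
  · exact hnt

lemma projective_of_retract {M P : Type u} [AddCommGroup M] [Module Λ M] [AddCommGroup P]
    [Module Λ P] (hP : Module.Projective Λ P) (i : M →ₗ[Λ] P) (r : P →ₗ[Λ] M)
    (h : ∀ m, r (i m) = m) : Module.Projective Λ M :=
  Module.Projective.of_split i r (LinearMap.ext h)

lemma GoodMap.ext_us {M P F : Type u} [AddCommGroup M] [Module Λ M] [AddCommGroup P] [Module Λ P]
    [AddCommGroup F] [Module Λ F] {i : M →ₗ[Λ] P} (hi : GoodMap i) (hF : US (Λ := Λ) F)
    (hFp : Module.Projective Λ F) (g : M →ₗ[Λ] F) : ∃ h : P →ₗ[Λ] F, ∀ m, h (i m) = g m := by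
  obtain ⟨c, hc⟩ := hF.exists_surj
  obtain ⟨t, ht⟩ := aux_projLift hFp c hc LinearMap.id
  obtain ⟨h, hh⟩ := hi (t ∘ₗ g)
  exact ⟨c ∘ₗ h, fun m => by rw [LinearMap.comp_apply, hh, LinearMap.comp_apply, ht]; rfl⟩

lemma GoodMap.ext_fin {M P F : Type u} [AddCommGroup M] [Module Λ M] [AddCommGroup P] [Module Λ P]
    [AddCommGroup F] [Module Λ F] {i : M →ₗ[Λ] P} (hi : GoodMap i) (hM : Module.Finite Λ M)
    (hFp : Module.Projective Λ F) (g : M →ₗ[Λ] F) : ∃ h : P →ₗ[Λ] F, ∀ m, h (i m) = g m := by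
  classical
  obtain ⟨t, ht⟩ := Module.projective_def'.1 hFp
  let g' : M →ₗ[Λ] (F →₀ Λ) := t ∘ₗ g
  obtain ⟨s, hs⟩ := hM.fg_top
  have hsupp : ∀ m, g' m ∈ Finsupp.supported Λ Λ (↑(s.biUnion (fun m => (g' m).support)) : Set F) := by
    have : (⊤ : Submodule Λ M) ≤ (Finsupp.supported Λ Λ
        (↑(s.biUnion (fun m => (g' m).support)) : Set F)).comap g' := by
      rw [← hs, Submodule.span_le]
      intro x hx
      simp only [Submodule.comap_coe, Set.mem_preimage, SetLike.mem_coe, Finsupp.mem_supported]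
      intro y hy
      simp only [Finset.coe_biUnion, Set.mem_iUnion]
      exact ⟨x, hx, hy⟩
    exact fun m => this trivial
  choose h hh using fun k : F => hi (Finsupp.lapply k ∘ₗ g')
  refine ⟨Finsupp.linearCombination Λ id ∘ₗ
    (∑ k ∈ s.biUnion (fun m => (g' m).support), Finsupp.lsingle k ∘ₗ h k), fun m => ?_⟩
  have : (∑ k ∈ s.biUnion (fun m => (g' m).support), Finsupp.lsingle k ∘ₗ h k) (i m) = g' m := by
    simp only [LinearMap.sum_apply, LinearMap.comp_apply, hh, Finsupp.lsingle_apply,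
      Finsupp.lapply_apply]
    have h1 := (Finsupp.mem_supported Λ (g' m)).1 (hsupp m)
    conv_rhs => rw [← Finsupp.sum_single (g' m)]
    rw [Finsupp.sum_of_support_subset _ (by exact_mod_cast h1) _ (by simp)]
  rw [LinearMap.comp_apply, this]
  exact LinearMap.congr_fun ht (g m)

lemma US.proj_of_sub [hN : IsNakayama Λ] {W R : Type u} [AddCommGroup W] [Module Λ W]
    [AddCommGroup R] [Module Λ R] (hW : US (Λ := Λ) W) (hR : Module.Projective Λ R) [Nontrivial R]
    (j : R →ₗ[Λ] W) (hj : Function.Injective j) : Module.Projective Λ W := by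
  have : Nontrivial W := hj.nontrivial
  obtain ⟨P, _, _, p, hP, hPp, hp⟩ := hW.cover
  obtain ⟨k, hk⟩ := aux_projLift hR p hp j
  rcases hP.uni (LinearMap.ker p) (LinearMap.range k) with h | h
  · have : Function.Injective p := by
      rw [injective_iff_map_eq_zero]
      intro x hx
      obtain ⟨y, rfl⟩ := h hx
      rw [hk] at hx
      rw [hj (hx.trans (map_zero j).symm), map_zero]
    exact Module.Projective.of_equiv (LinearEquiv.ofBijective p ⟨this, hp⟩)
  · exfalso
    obtain ⟨x, hx⟩ := exists_ne (0 : R)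
    apply hx; apply hj
    rw [map_zero, ← hk]
    exact h ⟨x, rfl⟩

/-- In a uniserial module, if two maps out have ranges... : a nonzero map kernel comparison. -/
lemma US.ker_le {P A : Type u} [AddCommGroup P] [Module Λ P] [AddCommGroup A] [Module Λ A]
    (hP : US (Λ := Λ) P) (f : P →ₗ[Λ] A) (N : Submodule Λ P) (x : P) (hx : x ∈ N)
    (hfx : f x ≠ 0) : LinearMap.ker f ≤ N := by
  rcases hP.uni (LinearMap.ker f) N with h | h
  · exact h
  · exact absurd (h hx) hfx

/-- a projective quotient of a uniserial module by a nonzero submodule is zero -/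
lemma US.quot_nonproj {P A : Type u} [AddCommGroup P] [Module Λ P] [AddCommGroup A] [Module Λ A]
    (hP : US (Λ := Λ) P) (f : P →ₗ[Λ] A) (hf : Function.Surjective f) [Nontrivial A]
    (x : P) (hx : x ≠ 0) (hfx : f x = 0) : ¬ Module.Projective Λ A := by
  intro hA
  obtain ⟨t, ht⟩ := aux_projLift hA f hf LinearMap.id
  obtain ⟨a, ha⟩ := exists_ne (0 : A)
  have h1 := hP.ker_le f (LinearMap.range t) (t a) ⟨a, rfl⟩ (by rw [ht]; exact ha)
  obtain ⟨b, rfl⟩ := h1 hfx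
  rw [ht] at hfx
  apply hx
  rw [show b = 0 from hfx, map_zero]

lemma goodMap_of_black [hN : IsNakayama Λ] {M P : Type u} [AddCommGroup M] [Module Λ M]
    [AddCommGroup P] [Module Λ P] (hP : US (Λ := Λ) P)
    (hb : BlackMod (Λ := Λ) P) (i : M →ₗ[Λ] P) (hi : Function.Injective i)
    (_hs : ¬ Function.Surjective i) : GoodMap i := by
  have := hN.artinian
  have step : ∀ (R : Type u) [AddCommGroup R] [Module Λ R], US (Λ := Λ) R →
      Module.Projective Λ R → ∀ g : M →ₗ[Λ] R, ∃ h : P →ₗ[Λ] R, ∀ m, h (i m) = g m := by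
    intro R _ _ hR hRp g
    by_cases hg0 : g = 0
    · exact ⟨0, fun m => by simp [hg0]⟩
    obtain ⟨m0, hm0⟩ : ∃ m, g m ≠ 0 := by
      by_contra hc; push Not at hc; exact hg0 (LinearMap.ext hc)
    have : Nontrivial R := ⟨⟨_, _, hm0⟩⟩
    by_cases hg : Function.Injective g
    · have : Nontrivial M := ⟨⟨m0, 0, fun h => hm0 (by rw [h, map_zero])⟩⟩
      rcases amalg hP hR i hi g hg with ⟨h, -, hh⟩ | ⟨h, hinj, hh⟩
      · exact ⟨h, hh⟩
      · rcases hb (LinearMap.range h)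
          (Module.Projective.of_equiv (LinearEquiv.ofInjective h hinj)) with h1 | h1
        · exfalso
          obtain ⟨x, hx⟩ := exists_ne (0 : R)
          apply hx; apply hinj
          have : h x ∈ LinearMap.range h := ⟨x, rfl⟩
          rw [h1] at this
          simpa using this
        · let e := LinearEquiv.ofBijective h ⟨hinj, LinearMap.range_eq_top.1 h1⟩
          refine ⟨e.symm.toLinearMap, fun m => ?_⟩
          rw [← hh]
          exact e.symm_apply_apply _
    · let K := LinearMap.ker g
      let K' := K.map i
      obtain ⟨ib, hib⟩ := aux_desc K.mkQ K.mkQ_surjective (K'.mkQ ∘ₗ i) (fun a ha => by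
        have : a ∈ K := by simpa using ha
        simpa using Submodule.mem_map_of_mem this)
      obtain ⟨gb, hgb⟩ := aux_desc K.mkQ K.mkQ_surjective g (fun a ha => by
        have : a ∈ K := by simpa using ha
        exact this)
      have hibi : Function.Injective ib := by
        rw [injective_iff_map_eq_zero]
        intro x hx
        obtain ⟨x, rfl⟩ := K.mkQ_surjective x
        rw [hib] at hx
        have : i x ∈ K' := by simpa using hx
        obtain ⟨y, hy, hyx⟩ := this
        rw [← hi hyx]
        simpa using hy
      have hgbi : Function.Injective gb := by
        rw [injective_iff_map_eq_zero]
        intro x hx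
        obtain ⟨x, rfl⟩ := K.mkQ_surjective x
        rw [hgb] at hx
        simpa using (show x ∈ K from hx)
      have hUS : US (Λ := Λ) (P ⧸ K') := hP.of_surj K'.mkQ K'.mkQ_surjective
      have hm1 : K.mkQ m0 ≠ 0 := fun h => hm0 (by rw [← hgb, h, map_zero])
      have : Nontrivial (M ⧸ K) := ⟨⟨_, _, hm1⟩⟩
      rcases amalg hUS hR ib hibi gb hgbi with ⟨h, -, hh⟩ | ⟨h, hinj, hh⟩
      · refine ⟨h ∘ₗ K'.mkQ, fun m => ?_⟩
        rw [LinearMap.comp_apply, ← hgb, ← hh, hib, LinearMap.comp_apply]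
      · exfalso
        have hpr := hUS.proj_of_sub hRp h hinj
        rw [injective_iff_map_eq_zero] at hg
        push Not at hg
        obtain ⟨a, ha, ha0⟩ := hg
        have : Nontrivial (P ⧸ K') := hibi.nontrivial
        refine hP.quot_nonproj K'.mkQ K'.mkQ_surjective (i a) (fun h => ha0 (hi (by rw [h, map_zero])))
          ?_ hpr
        exact (Submodule.Quotient.mk_eq_zero K').2 (Submodule.mem_map_of_mem (f := i) (show a ∈ K from ha))
  intro g
  have : ∀ e ∈ AddSubmonoid.closure (UEnd (Λ := Λ)), ∃ h : P →ₗ[Λ] Λ, ∀ m, h (i m) = e (g m) := by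
    intro e he
    induction he using AddSubmonoid.closure_induction with
    | zero => exact ⟨0, by simp⟩
    | add e f _ _ h1 h2 =>
      obtain ⟨h1, hh1⟩ := h1
      obtain ⟨h2, hh2⟩ := h2
      exact ⟨h1 + h2, by simp [hh1, hh2]⟩
    | mem e he =>
      obtain ⟨R, _, _, ι, π, hR, hRp, rfl⟩ := he
      obtain ⟨h, hh⟩ := step R hR hRp (π ∘ₗ g)
      exact ⟨ι ∘ₗ h, fun m => by simp [hh]⟩
  exact this _ id_mem_closure

/-- a linear map which is the identity on a nonzero submodule of a uniserial module is bijective -/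
lemma US.bij_of_fix [IsArtinianRing Λ] {M P : Type u} [AddCommGroup M] [Module Λ M]
    [AddCommGroup P] [Module Λ P] [Nontrivial M] (hP : US (Λ := Λ) P) (i : M →ₗ[Λ] P)
    (hi : Function.Injective i) (h : P →ₗ[Λ] P) (hh : ∀ m, h (i m) = i m) :
    Function.Bijective h := by
  have := hP.fin
  have hinj : Function.Injective h := by
    obtain ⟨m, hm⟩ := exists_ne (0 : M)
    have h1 := hP.ker_le h (LinearMap.range i) (i m) ⟨m, rfl⟩
      (by rw [hh]; exact fun h => hm (hi (by rw [h, map_zero])))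
    rw [injective_iff_map_eq_zero]
    intro x hx
    obtain ⟨y, rfl⟩ := h1 hx
    rwa [hh] at hx
  exact IsArtinian.bijective_of_injective_endomorphism h hinj

structure SES {M P N : Type u} [AddCommGroup M] [Module Λ M] [AddCommGroup P] [Module Λ P]
    [AddCommGroup N] [Module Λ N] (i : M →ₗ[Λ] P) (p : P →ₗ[Λ] N) : Prop where
  inj : Function.Injective i
  surj : Function.Surjective p
  exact : ∀ x, p x = 0 ↔ ∃ m, i m = x

def GG (G : Type u) [AddCommGroup G] [Module Λ G] : Prop :=
  ∃ (P : ℤ → ModuleCat.{u} Λ) (d : ∀ i, P (i + 1) →ₗ[Λ] P i),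
    (∀ i, Module.Projective Λ (P i)) ∧
    (∀ i, Function.Exact (d (i + 1)) (d i)) ∧
    (∀ (i : ℤ) (φ : P (i + 1) →ₗ[Λ] Λ), φ.comp (d (i + 1)) = 0 →
      ∃ ψ : P i →ₗ[Λ] Λ, ψ.comp (d i) = φ) ∧
    ∃ k : ℤ, Nonempty (G ≃ₗ[Λ] LinearMap.range (d k))

lemma ses_range (P : ℤ → ModuleCat.{u} Λ) (d : ∀ i, P (i + 1) →ₗ[Λ] P i)
    (hex : ∀ i, Function.Exact (d (i + 1)) (d i))
    (hg : ∀ (i : ℤ) (φ : P (i + 1) →ₗ[Λ] Λ), φ.comp (d (i + 1)) = 0 →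
      ∃ ψ : P i →ₗ[Λ] Λ, ψ.comp (d i) = φ) (k : ℤ) :
    SES (LinearMap.range (d (k + 1))).subtype (d k).rangeRestrict ∧
      GoodMap (LinearMap.range (d (k + 1))).subtype := by
  refine ⟨⟨Submodule.injective_subtype _, LinearMap.surjective_rangeRestrict _, fun x => ?_⟩, ?_⟩
  · rw [← Subtype.coe_inj]
    simp only [LinearMap.codRestrict_apply, LinearMap.rangeRestrict, ZeroMemClass.coe_zero]
    rw [hex k x]
    constructor
    · intro h; exact ⟨⟨x, h⟩, rfl⟩
    · rintro ⟨m, rfl⟩; exact m.2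
  · intro g
    obtain ⟨ψ, hψ⟩ := hg (k + 1) (g ∘ₗ (d (k + 1)).rangeRestrict) (by
      ext x
      have : (d (k + 1)).rangeRestrict (d (k + 1 + 1) x) = 0 := by
        rw [← Subtype.coe_inj]
        exact (hex (k + 1) _).2 ⟨x, rfl⟩
      simp [this])
    refine ⟨ψ, ?_⟩
    rintro ⟨_, y, rfl⟩
    exact LinearMap.congr_fun hψ y

lemma GG.syz {G : Type u} [AddCommGroup G] [Module Λ G] (h : GG (Λ := Λ) G) :
    ∃ (H P : Type u) (_ : AddCommGroup H) (_ : Module Λ H) (_ : AddCommGroup P) (_ : Module Λ P)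
      (j : H →ₗ[Λ] P) (q : P →ₗ[Λ] G), GG (Λ := Λ) H ∧ Module.Projective Λ P ∧ SES j q ∧
        GoodMap j := by
  obtain ⟨P, d, hp, hex, hg, k, ⟨e⟩⟩ := h
  obtain ⟨hs, hgo⟩ := ses_range P d hex hg k
  refine ⟨LinearMap.range (d (k + 1)), P (k + 1), inferInstance, inferInstance, inferInstance,
    inferInstance, (LinearMap.range (d (k + 1))).subtype, e.symm.toLinearMap ∘ₗ (d k).rangeRestrict,
    ⟨P, d, hp, hex, hg, k + 1, ⟨LinearEquiv.refl _ _⟩⟩, hp _, ⟨hs.inj, ?_, fun x => ?_⟩, hgo⟩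
  · exact e.symm.surjective.comp hs.surj
  · rw [← hs.exact]
    simp

lemma GG.cosyz {G : Type u} [AddCommGroup G] [Module Λ G] (h : GG (Λ := Λ) G) :
    ∃ (H P : Type u) (_ : AddCommGroup H) (_ : Module Λ H) (_ : AddCommGroup P) (_ : Module Λ P)
      (j : G →ₗ[Λ] P) (q : P →ₗ[Λ] H), GG (Λ := Λ) H ∧ Module.Projective Λ P ∧ SES j q ∧
        GoodMap j := by
  obtain ⟨P, d, hp, hex, hg, k', ⟨e⟩⟩ := h
  obtain ⟨k, rfl⟩ : ∃ k, k' = k + 1 := ⟨k' - 1, by omega⟩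
  obtain ⟨hs, hgo⟩ := ses_range P d hex hg k
  refine ⟨LinearMap.range (d k), P (k + 1), inferInstance, inferInstance, inferInstance,
    inferInstance, (LinearMap.range (d (k + 1))).subtype ∘ₗ e.toLinearMap, (d k).rangeRestrict,
    ⟨P, d, hp, hex, hg, k, ⟨LinearEquiv.refl _ _⟩⟩, hp _, ⟨hs.inj.comp e.injective, hs.surj,
      fun x => ?_⟩, fun g => ?_⟩
  · rw [hs.exact]
    constructor
    · rintro ⟨m, rfl⟩; exact ⟨e.symm m, by simp⟩
    · rintro ⟨m, rfl⟩; exact ⟨e m, rfl⟩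
  · obtain ⟨h, hh⟩ := hgo (g ∘ₗ e.symm.toLinearMap)
    exact ⟨h, fun m => by simpa using hh (e m)⟩

structure G0 (M : Type u) [AddCommGroup M] [Module Λ M] : Prop where
  us : US (Λ := Λ) M
  np : ¬ Module.Projective Λ M
  ret : ∃ (G : Type u) (_ : AddCommGroup G) (_ : Module Λ G) (i : M →ₗ[Λ] G) (r : G →ₗ[Λ] M),
    GG (Λ := Λ) G ∧ ∀ m, r (i m) = m

structure Step {M P N : Type u} [AddCommGroup M] [Module Λ M] [AddCommGroup P] [Module Λ P]
    [AddCommGroup N] [Module Λ N] (i : M →ₗ[Λ] P) (p : P →ₗ[Λ] N) : Prop extends SES i p where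
  us : US (Λ := Λ) P
  proj : Module.Projective Λ P
  black : BlackMod (Λ := Λ) P

lemma inv_of_bij {P : Type u} [AddCommGroup P] [Module Λ P] (h : P →ₗ[Λ] P)
    (hb : Function.Bijective h) : ∃ u : P →ₗ[Λ] P, (∀ x, u (h x) = x) ∧ ∀ x, h (u x) = x := by
  let e := LinearEquiv.ofBijective h hb
  exact ⟨e.symm.toLinearMap, e.symm_apply_apply, e.apply_symm_apply⟩

lemma black_of_good [hN : IsNakayama Λ] {M P : Type u} [AddCommGroup M] [Module Λ M]
    [AddCommGroup P] [Module Λ P] [Nontrivial M] (hP : US (Λ := Λ) P)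
    (i : M →ₗ[Λ] P) (hi : Function.Injective i) (hs : ¬ Function.Surjective i) (hg : GoodMap i) :
    BlackMod (Λ := Λ) P := by
  have := hN.artinian
  have key : ∀ R : Submodule Λ P, Module.Projective Λ R → LinearMap.range i ≤ R → R = ⊤ := by
    intro R hR hle
    obtain ⟨g, hgg⟩ := aux_lift R.subtype R.injective_subtype i (fun m => ⟨⟨i m, hle ⟨m, rfl⟩⟩, rfl⟩)
    obtain ⟨h, hh⟩ := hg.ext_us (hP.of_inj R.subtype R.injective_subtype) hR g
    have hb := hP.bij_of_fix i hi (R.subtype ∘ₗ h) (fun m => by rw [LinearMap.comp_apply, hh, hgg])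
    rw [eq_top_iff]
    intro x _
    obtain ⟨y, rfl⟩ := hb.2 x
    exact (h y).2
  intro R hR
  rcases hP.uni R (LinearMap.range i) with h | h
  · left
    by_contra hne
    have : Nontrivial R := Submodule.nontrivial_iff_ne_bot.2 hne
    have := US.proj_of_sub (hP.of_inj _ (LinearMap.range i).injective_subtype) hR
      (Submodule.inclusion h) (Submodule.inclusion_injective h)
    exact hs (LinearMap.range_eq_top.1 (key _ this le_rfl))
  · exact Or.inr (key R hR h)

lemma Step.nonproj_left {M P N : Type u} [AddCommGroup M] [Module Λ M] [AddCommGroup P] [Module Λ P]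
    [AddCommGroup N] [Module Λ N] {i : M →ₗ[Λ] P} {p : P →ₗ[Λ] N} (h : Step i p)
    (hN : ¬ Module.Projective Λ N) : ¬ Module.Projective Λ M := by
  intro hM
  have := nontrivial_of_nonproj hN
  rcases h.black (LinearMap.range i)
    (Module.Projective.of_equiv (LinearEquiv.ofInjective i h.inj)) with h1 | h1
  · apply hN
    have hpi : Function.Injective p := by
      rw [injective_iff_map_eq_zero]
      intro x hx
      have : x ∈ LinearMap.range i := (h.exact x).1 hx
      rw [h1] at this
      simpa using this
    have := h.proj
    exact Module.Projective.of_equiv (LinearEquiv.ofBijective p ⟨hpi, h.surj⟩)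
  · obtain ⟨n, hn⟩ := exists_ne (0 : N)
    obtain ⟨x, rfl⟩ := h.surj n
    exact hn ((h.exact x).2 (LinearMap.range_eq_top.1 h1 x))

lemma SES.not_surj {M P N : Type u} [AddCommGroup M] [Module Λ M] [AddCommGroup P] [Module Λ P]
    [AddCommGroup N] [Module Λ N] {i : M →ₗ[Λ] P} {p : P →ₗ[Λ] N} (h : SES i p) [Nontrivial N] :
    ¬ Function.Surjective i := by
  intro hs
  obtain ⟨n, hn⟩ := exists_ne (0 : N)
  obtain ⟨x, rfl⟩ := h.surj n
  exact hn ((h.exact x).2 (hs x))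

lemma SES.of_ker {P N : Type u} [AddCommGroup P] [Module Λ P]
    [AddCommGroup N] [Module Λ N] (p : P →ₗ[Λ] N) (hp : Function.Surjective p) :
    SES (LinearMap.ker p).subtype p :=
  ⟨Submodule.injective_subtype _, hp, fun x => ⟨fun h => ⟨⟨x, h⟩, rfl⟩, by rintro ⟨m, rfl⟩; exact m.2⟩⟩

lemma SES.of_quot {M P : Type u} [AddCommGroup P] [Module Λ P]
    [AddCommGroup M] [Module Λ M] (i : M →ₗ[Λ] P) (hi : Function.Injective i) :
    SES i (LinearMap.range i).mkQ :=
  ⟨hi, Submodule.mkQ_surjective _, fun x => by simp⟩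

lemma Step.nonproj_right {M P N : Type u} [AddCommGroup M] [Module Λ M] [AddCommGroup P]
    [Module Λ P] [AddCommGroup N] [Module Λ N] {i : M →ₗ[Λ] P} {p : P →ₗ[Λ] N} (h : Step i p)
    (hM : ¬ Module.Projective Λ M) : ¬ Module.Projective Λ N := by
  have := nontrivial_of_nonproj hM
  have : Nontrivial N := by
    rcases subsingleton_or_nontrivial N with hs | hnt
    · exfalso
      apply hM
      have := h.proj
      exact Module.Projective.of_equiv (LinearEquiv.ofBijective i ⟨h.inj, fun x =>
        (h.exact x).1 (Subsingleton.elim _ _)⟩).symm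
    · exact hnt
  obtain ⟨m, hm⟩ := exists_ne (0 : M)
  exact h.us.quot_nonproj p h.surj (i m) (fun hh => hm (h.inj (by rw [hh, map_zero])))
    ((h.exact _).2 ⟨m, rfl⟩)

lemma G0.syz [hN : IsNakayama Λ] {N : Type u} [AddCommGroup N] [Module Λ N] (h : G0 (Λ := Λ) N) :
    ∃ (M P : Type u) (_ : AddCommGroup M) (_ : Module Λ M) (_ : AddCommGroup P) (_ : Module Λ P)
      (i : M →ₗ[Λ] P) (p : P →ₗ[Λ] N), G0 (Λ := Λ) M ∧ Step i p := by
  have := hN.artinian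
  have hnt := nontrivial_of_nonproj h.np
  obtain ⟨P, _, _, p, hP, hPp, hp⟩ := h.us.cover
  have := hP.fin
  obtain ⟨G, _, _, i, r, hG, hri⟩ := h.ret
  obtain ⟨H, P1, _, _, _, _, j, q, hH, hP1, hs, hg⟩ := hG.syz
  obtain ⟨a, ha⟩ := aux_projLift hPp q hs.surj (i ∘ₗ p)
  obtain ⟨b, hb⟩ := aux_projLift hP1 p hp (r ∘ₗ q)
  simp only [LinearMap.comp_apply] at ha hb
  have hpba : ∀ x, p ((b ∘ₗ a) x) = p x := fun x => by
    rw [LinearMap.comp_apply, hb, ha, hri]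
  have hsurj : Function.Surjective (b ∘ₗ a) := by
    obtain ⟨n, hn⟩ := exists_ne (0 : N)
    obtain ⟨x, rfl⟩ := hp n
    have h1 := hP.ker_le p (LinearMap.range (b ∘ₗ a)) ((b ∘ₗ a) x) ⟨x, rfl⟩ (by rw [hpba]; exact hn)
    intro y
    have : y - (b ∘ₗ a) y ∈ LinearMap.ker p := by
      rw [LinearMap.mem_ker, map_sub, hpba, sub_self]
    obtain ⟨z, hz⟩ := h1 this
    exact ⟨z + y, by rw [map_add, hz]; simp⟩
  have hbij : Function.Bijective (b ∘ₗ a) :=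
    IsNoetherian.bijective_of_surjective_endomorphism _ hsurj
  obtain ⟨v, hv1, hv2⟩ := inv_of_bij _ hbij
  have hpv : ∀ x, p (v x) = p x := fun x => by rw [← hpba, hv2]
  have hses := SES.of_ker p hp
  obtain ⟨i', hi'⟩ := aux_lift j hs.inj (a ∘ₗ (LinearMap.ker p).subtype) (fun m => by
    rw [← hs.exact, LinearMap.comp_apply, ha, (hses.exact _).2 ⟨m, rfl⟩, map_zero])
  obtain ⟨r', hr'⟩ := aux_lift _ hses.inj (v ∘ₗ b ∘ₗ j) (fun m => by
    rw [← hses.exact, LinearMap.comp_apply, hpv, LinearMap.comp_apply, hb, (hs.exact _).2 ⟨m, rfl⟩,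
      map_zero])
  have hri' : ∀ m, r' (i' m) = m := fun m => hses.inj (by
    rw [hr', LinearMap.comp_apply, LinearMap.comp_apply, hi', LinearMap.comp_apply]
    exact hv1 _)
  have hgood : GoodMap (LinearMap.ker p).subtype := by
    intro g
    obtain ⟨ψ, hψ⟩ := hg (g ∘ₗ r')
    exact ⟨ψ ∘ₗ a, fun m => by
      have := hi' m
      rw [LinearMap.comp_apply] at this
      rw [LinearMap.comp_apply, ← this, hψ, LinearMap.comp_apply, hri']⟩
  have hker : Nontrivial (LinearMap.ker p) := by
    rw [Submodule.nontrivial_iff_ne_bot]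
    intro hk
    exact h.np (Module.Projective.of_equiv (LinearEquiv.ofBijective p ⟨LinearMap.ker_eq_bot.1 hk, hp⟩))
  have hstep : Step (LinearMap.ker p).subtype p :=
    ⟨hses, hP, hPp, black_of_good hP _ hses.inj hses.not_surj hgood⟩
  exact ⟨LinearMap.ker p, P, _, _, _, _, _, p, ⟨hP.of_inj _ hses.inj, hstep.nonproj_left h.np,
    H, _, _, i', r', hH, hri'⟩, hstep⟩

lemma G0.cosyz [hN : IsNakayama Λ] {M : Type u} [AddCommGroup M] [Module Λ M] (h : G0 (Λ := Λ) M) :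
    ∃ (N P : Type u) (_ : AddCommGroup N) (_ : Module Λ N) (_ : AddCommGroup P) (_ : Module Λ P)
      (i : M →ₗ[Λ] P) (p : P →ₗ[Λ] N), G0 (Λ := Λ) N ∧ Step i p := by
  have := hN.artinian
  have hnt := nontrivial_of_nonproj h.np
  obtain ⟨G, _, _, i, r, hG, hri⟩ := h.ret
  obtain ⟨H, P0, _, _, _, _, j, q, hH, hP0, hs, hg⟩ := hG.cosyz
  have hii : Function.Injective i := Function.LeftInverse.injective hri
  obtain ⟨Q0, _, _, e0, hQ0, hQ0p, he0⟩ := h.us.embed hP0 (j ∘ₗ i) (hs.inj.comp hii)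
  have := hQ0.fin
  obtain ⟨Q, ⟨hQp, hQle⟩, hmin⟩ := WellFounded.has_min
    (wellFounded_lt : WellFounded (fun a b : Submodule Λ Q0 => a < b))
    {R | Module.Projective Λ R ∧ LinearMap.range e0 ≤ R}
    ⟨⊤, Module.Projective.of_equiv Submodule.topEquiv.symm, le_top⟩
  obtain ⟨e, he⟩ := aux_lift Q.subtype Q.injective_subtype e0
    (fun m => ⟨⟨e0 m, hQle ⟨m, rfl⟩⟩, rfl⟩)
  have hei : Function.Injective e := fun x y hxy => he0 (by rw [← he, ← he, hxy])
  have hQ : US (Λ := Λ) Q := hQ0.of_inj _ Q.injective_subtype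
  have hblack : BlackMod (Λ := Λ) Q := by
    intro R hR
    rcases hQ.uni R (LinearMap.range e) with h1 | h1
    · left
      by_contra hne
      have : Nontrivial R := Submodule.nontrivial_iff_ne_bot.2 hne
      have := US.proj_of_sub (hQ.of_inj _ (LinearMap.range e).injective_subtype) hR
        (Submodule.inclusion h1) (Submodule.inclusion_injective h1)
      exact h.np (Module.Projective.of_equiv (LinearEquiv.ofInjective e hei).symm)
    · right
      by_contra hne
      have hmapp : Module.Projective Λ (R.map Q.subtype) :=
        Module.Projective.of_equiv (Submodule.equivMapOfInjective Q.subtype Q.injective_subtype R)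
      refine hmin (R.map Q.subtype) ⟨hmapp, ?_⟩ ?_
      · rintro _ ⟨m, rfl⟩
        exact ⟨e m, h1 ⟨m, rfl⟩, he m⟩
      · refine lt_of_le_of_ne (Submodule.map_subtype_le _ _) (fun hh => hne ?_)
        rw [eq_top_iff]
        rintro ⟨x, hx⟩ _
        have hx2 : x ∈ R.map Q.subtype := by rw [hh]; exact hx
        obtain ⟨y, hy, hyx⟩ := hx2
        have : y = ⟨x, hx⟩ := Subtype.ext hyx
        rwa [← this]
  have hens : ¬ Function.Surjective e := fun hes =>
    h.np (Module.Projective.of_equiv (LinearEquiv.ofBijective e ⟨hei, hes⟩).symm)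
  have hgood := goodMap_of_black hQ hblack e hei hens
  have hses := SES.of_quot e hei
  have hstep : Step e (LinearMap.range e).mkQ := ⟨hses, hQ, hQp, hblack⟩
  obtain ⟨a, ha⟩ := hgood.ext_fin h.us.fin hP0 (j ∘ₗ i)
  obtain ⟨b, hb⟩ := hg.ext_us hQ hQp (e ∘ₗ r)
  simp only [LinearMap.comp_apply] at ha hb
  have hbij := hQ.bij_of_fix e hei (b ∘ₗ a) (fun m => by rw [LinearMap.comp_apply, ha, hb, hri])
  obtain ⟨v, hv1, hv2⟩ := inv_of_bij _ hbij
  have hve : ∀ m, v (e m) = e m := fun m => by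
    have := hv1 (e m)
    rwa [LinearMap.comp_apply, ha, hb, hri] at this
  obtain ⟨i', hi'⟩ := aux_desc _ hses.surj (q ∘ₗ a) (fun x hx => by
    obtain ⟨m, rfl⟩ := (hses.exact x).1 hx
    rw [LinearMap.comp_apply, ha]
    exact (hs.exact _).2 ⟨_, rfl⟩)
  obtain ⟨r', hr'⟩ := aux_desc q hs.surj ((LinearMap.range e).mkQ ∘ₗ v ∘ₗ b) (fun x hx => by
    obtain ⟨m, rfl⟩ := (hs.exact x).1 hx
    rw [LinearMap.comp_apply, LinearMap.comp_apply, hb, hve]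
    exact (hses.exact _).2 ⟨_, rfl⟩)
  refine ⟨Q ⧸ LinearMap.range e, Q, inferInstance, inferInstance, inferInstance, inferInstance, e, _,
    ⟨hQ.of_surj _ hses.surj, hstep.nonproj_right h.np, H, _, _, i', r', hH, fun x => ?_⟩, hstep⟩
  obtain ⟨x, rfl⟩ := hses.surj x
  rw [hi', LinearMap.comp_apply, hr']
  exact congrArg _ (hv1 x)

def TC (A M : Type u) [AddCommGroup A] [Module Λ A] [AddCommGroup M] [Module Λ M] : Prop :=
  (∃ f : A →ₗ[Λ] M, Function.Surjective f) ∨ (∃ f : M →ₗ[Λ] A, Function.Surjective f)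

def SC (A M : Type u) [AddCommGroup A] [Module Λ A] [AddCommGroup M] [Module Λ M] : Prop :=
  (∃ f : A →ₗ[Λ] M, Function.Injective f) ∨ (∃ f : M →ₗ[Λ] A, Function.Injective f)

lemma US.tc {W A B : Type u} [AddCommGroup W] [Module Λ W] [AddCommGroup A] [Module Λ A]
    [AddCommGroup B] [Module Λ B] (h : US (Λ := Λ) W) (p : W →ₗ[Λ] A) (hp : Function.Surjective p)
    (q : W →ₗ[Λ] B) (hq : Function.Surjective q) : TC (Λ := Λ) A B := by
  rcases h.uni (LinearMap.ker p) (LinearMap.ker q) with h1 | h1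
  · left
    obtain ⟨g, hg⟩ := aux_desc p hp q (fun a ha => h1 ha)
    exact ⟨g, fun b => by obtain ⟨w, rfl⟩ := hq b; exact ⟨p w, hg w⟩⟩
  · right
    obtain ⟨g, hg⟩ := aux_desc q hq p (fun a ha => h1 ha)
    exact ⟨g, fun b => by obtain ⟨w, rfl⟩ := hp b; exact ⟨q w, hg w⟩⟩

lemma US.sc {W A B : Type u} [AddCommGroup W] [Module Λ W] [AddCommGroup A] [Module Λ A]
    [AddCommGroup B] [Module Λ B] (h : US (Λ := Λ) W) (i : A →ₗ[Λ] W) (hi : Function.Injective i)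
    (j : B →ₗ[Λ] W) (hj : Function.Injective j) : SC (Λ := Λ) A B := by
  rcases h.uni (LinearMap.range i) (LinearMap.range j) with h1 | h1
  · left
    obtain ⟨g, hg⟩ := aux_lift j hj i (fun a => h1 ⟨a, rfl⟩)
    exact ⟨g, fun x y hxy => hi (by rw [← hg, ← hg, hxy])⟩
  · right
    obtain ⟨g, hg⟩ := aux_lift i hi j (fun a => h1 ⟨a, rfl⟩)
    exact ⟨g, fun x y hxy => hj (by rw [← hg, ← hg, hxy])⟩

lemma syzSurj {M P N M' P' N' : Type u} [AddCommGroup M] [Module Λ M] [AddCommGroup P] [Module Λ P]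
    [AddCommGroup N] [Module Λ N] [AddCommGroup M'] [Module Λ M'] [AddCommGroup P'] [Module Λ P']
    [AddCommGroup N'] [Module Λ N'] [Nontrivial N] {i : M →ₗ[Λ] P} {p : P →ₗ[Λ] N} (h : SES i p)
    {i' : M' →ₗ[Λ] P'} {p' : P' →ₗ[Λ] N'} (h' : SES i' p') (hP : Module.Projective Λ P)
    (hP' : US (Λ := Λ) P') (f : N →ₗ[Λ] N') (hf : Function.Injective f) :
    ∃ g : M →ₗ[Λ] M', Function.Surjective g := by
  obtain ⟨v, hv⟩ := aux_projLift hP p' h'.surj (f ∘ₗ p)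
  simp only [LinearMap.comp_apply] at hv
  obtain ⟨g, hg⟩ := aux_lift i' h'.inj (v ∘ₗ i) (fun m => by
    rw [← h'.exact, LinearMap.comp_apply, hv, (h.exact _).2 ⟨m, rfl⟩, map_zero])
  refine ⟨g, fun m' => ?_⟩
  obtain ⟨n, hn⟩ := exists_ne (0 : N)
  obtain ⟨x, rfl⟩ := h.surj n
  have h1 := hP'.ker_le p' (LinearMap.range v) (v x) ⟨x, rfl⟩
    (by rw [hv]; exact fun hh => hn (hf (by rw [hh, map_zero])))
  have h2 : p' (i' m') = 0 := (h'.exact _).2 ⟨m', rfl⟩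
  obtain ⟨y, hy⟩ := h1 h2
  have h3 : p y = 0 := hf (by rw [← hv, hy, h2, map_zero])
  obtain ⟨m, rfl⟩ := (h.exact y).1 h3
  exact ⟨m, h'.inj (by rw [hg, ← hy]; rfl)⟩

lemma cosyzInj {M P N M' P' N' : Type u} [AddCommGroup M] [Module Λ M] [AddCommGroup P] [Module Λ P]
    [AddCommGroup N] [Module Λ N] [AddCommGroup M'] [Module Λ M'] [AddCommGroup P'] [Module Λ P']
    [AddCommGroup N'] [Module Λ N'] [Nontrivial M'] {i : M →ₗ[Λ] P} {p : P →ₗ[Λ] N} (h : SES i p)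
    {i' : M' →ₗ[Λ] P'} {p' : P' →ₗ[Λ] N'} (h' : SES i' p') (hg : GoodMap i)
    (hP : US (Λ := Λ) P) (hP' : US (Λ := Λ) P') (hPp' : Module.Projective Λ P')
    (f : M →ₗ[Λ] M') (hf : Function.Surjective f) :
    ∃ g : N →ₗ[Λ] N', Function.Injective g := by
  obtain ⟨v, hv⟩ := hg.ext_us hP' hPp' (i' ∘ₗ f)
  simp only [LinearMap.comp_apply] at hv
  obtain ⟨g, hg⟩ := aux_desc p h.surj (p' ∘ₗ v) (fun x hx => by
    obtain ⟨m, rfl⟩ := (h.exact x).1 hx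
    rw [LinearMap.comp_apply, hv]
    exact (h'.exact _).2 ⟨_, rfl⟩)
  refine ⟨g, ?_⟩
  rw [injective_iff_map_eq_zero]
  intro n hn
  obtain ⟨x, rfl⟩ := h.surj n
  rw [hg] at hn
  obtain ⟨m', hm'⟩ := (h'.exact _).1 hn
  obtain ⟨m, rfl⟩ := hf m'
  obtain ⟨m1', hm1'⟩ := exists_ne (0 : M')
  obtain ⟨m1, rfl⟩ := hf m1'
  have h1 := hP.ker_le v (LinearMap.range i) (i m1) ⟨m1, rfl⟩
    (by rw [hv]; exact fun hh => hm1' (h'.inj (by rw [hh, map_zero])))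
  have h2 : x - i m ∈ LinearMap.ker v := by
    rw [LinearMap.mem_ker, map_sub, hv, hm', sub_self]
  obtain ⟨m2, hm2⟩ := h1 h2
  exact (h.exact x).2 ⟨m2 + m, by rw [map_add, hm2]; simp⟩

structure TT (M : Type u) [AddCommGroup M] [Module Λ M] : Prop where
  us : US (Λ := Λ) M
  np : ¬ Module.Projective Λ M
  top : ∃ (A : Type u) (_ : AddCommGroup A) (_ : Module Λ A), G0 (Λ := Λ) A ∧ TC (Λ := Λ) A M
  soc : ∃ (B : Type u) (_ : AddCommGroup B) (_ : Module Λ B), G0 (Λ := Λ) B ∧ SC (Λ := Λ) B M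

lemma Step.good [hN : IsNakayama Λ] {M P N : Type u} [AddCommGroup M] [Module Λ M] [AddCommGroup P]
    [Module Λ P] [AddCommGroup N] [Module Λ N] {i : M →ₗ[Λ] P} {p : P →ₗ[Λ] N} (h : Step i p)
    (hM : ¬ Module.Projective Λ M) : GoodMap i :=
  goodMap_of_black h.us h.black i h.inj (fun hs => hM (by
    have := h.proj
    exact Module.Projective.of_equiv (LinearEquiv.ofBijective i ⟨h.inj, hs⟩).symm))

lemma TT.syz [hN : IsNakayama Λ] {N : Type u} [AddCommGroup N] [Module Λ N] (h : TT (Λ := Λ) N) :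
    ∃ (M P : Type u) (_ : AddCommGroup M) (_ : Module Λ M) (_ : AddCommGroup P) (_ : Module Λ P)
      (i : M →ₗ[Λ] P) (p : P →ₗ[Λ] N), TT (Λ := Λ) M ∧ Step i p := by
  have := hN.artinian
  have hnt := nontrivial_of_nonproj h.np
  obtain ⟨A, _, _, hA, hAN⟩ := h.top
  obtain ⟨B, _, _, hB, hBN⟩ := h.soc
  have hntA := nontrivial_of_nonproj hA.np
  have hntB := nontrivial_of_nonproj hB.np
  obtain ⟨MA, P, _, _, _, _, iA, pA, hMA, hSA⟩ := hA.syz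
  obtain ⟨MB, PB, _, _, _, _, iB, pB, hMB, hSB⟩ := hB.syz
  obtain ⟨p, hp⟩ : ∃ p : P →ₗ[Λ] N, Function.Surjective p := by
    rcases hAN with ⟨f, hf⟩ | ⟨f, hf⟩
    · exact ⟨f ∘ₗ pA, hf.comp hSA.surj⟩
    · obtain ⟨p, hp⟩ := aux_projLift hSA.proj f hf pA
      refine ⟨p, ?_⟩
      obtain ⟨a, ha⟩ := exists_ne (0 : A)
      obtain ⟨x, rfl⟩ := hSA.surj a
      have h1 := h.us.ker_le f (LinearMap.range p) (p x) ⟨x, rfl⟩ (by rw [hp]; exact ha)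
      intro n
      obtain ⟨y, hy⟩ := hSA.surj (f n)
      have : n - p y ∈ LinearMap.ker f := by
        rw [LinearMap.mem_ker, map_sub, hp, hy, sub_self]
      obtain ⟨z, hz⟩ := h1 this
      exact ⟨z + y, by rw [map_add, hz]; simp⟩
  have hses := SES.of_ker p hp
  have hstep : Step (LinearMap.ker p).subtype p := ⟨hses, hSA.us, hSA.proj, hSA.black⟩
  refine ⟨LinearMap.ker p, P, _, _, _, _, _, p, ⟨hSA.us.of_inj _ hses.inj, hstep.nonproj_left h.np,
    ⟨MB, _, _, hMB, ?_⟩, ⟨MA, _, _, hMA, hSA.us.sc iA hSA.inj _ hses.inj⟩⟩, hstep⟩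
  rcases hBN with ⟨f, hf⟩ | ⟨f, hf⟩
  · exact Or.inl (syzSurj hSB.toSES hses hSB.proj hSA.us f hf)
  · exact Or.inr (syzSurj hses hSB.toSES hSA.proj hSB.us f hf)

lemma TT.cosyz [hN : IsNakayama Λ] {M : Type u} [AddCommGroup M] [Module Λ M]
    (h : TT (Λ := Λ) M) :
    ∃ (N P : Type u) (_ : AddCommGroup N) (_ : Module Λ N) (_ : AddCommGroup P) (_ : Module Λ P)
      (i : M →ₗ[Λ] P) (p : P →ₗ[Λ] N), TT (Λ := Λ) N ∧ Step i p := by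
  have := hN.artinian
  have hnt := nontrivial_of_nonproj h.np
  obtain ⟨A, _, _, hA, hAM⟩ := h.top
  obtain ⟨B, _, _, hB, hBM⟩ := h.soc
  have hntA := nontrivial_of_nonproj hA.np
  have hntB := nontrivial_of_nonproj hB.np
  obtain ⟨NA, PA, _, _, _, _, iA, pA, hNA, hSA⟩ := hA.cosyz
  obtain ⟨NB, Q, _, _, _, _, iB, pB, hNB, hSB⟩ := hB.cosyz
  obtain ⟨i, hi⟩ : ∃ i : M →ₗ[Λ] Q, Function.Injective i := by
    rcases hBM with ⟨f, hf⟩ | ⟨f, hf⟩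
    · rcases amalg h.us hSB.us f hf iB hSB.inj with ⟨k, hk, -⟩ | ⟨k, hk, -⟩
      · exact ⟨k, hk⟩
      · have : Nontrivial Q := hSB.inj.nontrivial
        exact absurd (h.us.proj_of_sub hSB.proj k hk) h.np
    · exact ⟨iB ∘ₗ f, hSB.inj.comp hf⟩
  have hses := SES.of_quot i hi
  have hstep : Step i (LinearMap.range i).mkQ := ⟨hses, hSB.us, hSB.proj, hSB.black⟩
  refine ⟨Q ⧸ LinearMap.range i, Q, inferInstance, inferInstance, inferInstance, inferInstance, i, _,
    ⟨hSB.us.of_surj _ hses.surj, hstep.nonproj_right h.np,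
    ⟨NB, _, _, hNB, hSB.us.tc pB hSB.surj _ hses.surj⟩, ⟨NA, _, _, hNA, ?_⟩⟩, hstep⟩
  rcases hAM with ⟨f, hf⟩ | ⟨f, hf⟩
  · exact Or.inl (cosyzInj hSA.toSES hses (hSA.good hA.np) hSA.us hSB.us hSB.proj f hf)
  · exact Or.inr (cosyzInj hses hSA.toSES (hstep.good h.np) hSB.us hSA.us hSA.proj f hf)

lemma exists_zseq {α : Type*} (R : α → α → Prop) (h1 : ∀ x, ∃ y, R y x) (h2 : ∀ x, ∃ y, R x y)
    (x0 : α) : ∃ Z : ℤ → α, Z 1 = x0 ∧ ∀ k, R (Z (k + 1)) (Z k) := by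
  choose a ha using h1
  choose b hb using h2
  let W : ℤ → α := fun k => match k with
    | Int.ofNat n => a^[n] x0
    | Int.negSucc n => b^[n + 1] x0
  have hW : ∀ k, R (W (k + 1)) (W k) := by
    intro k
    match k with
    | Int.ofNat n =>
      change R (a^[n + 1] x0) (a^[n] x0)
      rw [Function.iterate_succ_apply']; exact ha _
    | Int.negSucc 0 =>
      change R x0 (b x0)
      exact hb _
    | Int.negSucc (n + 1) =>
      change R (b^[n + 1] x0) (b^[n + 1 + 1] x0)
      rw [Function.iterate_succ_apply' b (n + 1)]; exact hb _
  refine ⟨fun k => W (k - 1), rfl, fun k => ?_⟩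
  have := hW (k - 1)
  rwa [show k - 1 + 1 = k + 1 - 1 by ring] at this

lemma TT.gp [hN : IsNakayama Λ] {M : Type u} [AddCommGroup M] [Module Λ M] (h : TT (Λ := Λ) M) :
    IsGorensteinProjective Λ M := by
  let R : {X : ModuleCat.{u} Λ // TT (Λ := Λ) X} → {X : ModuleCat.{u} Λ // TT (Λ := Λ) X} → Prop :=
    fun M N => ∃ (P : ModuleCat.{u} Λ) (i : M.1 →ₗ[Λ] P) (p : P →ₗ[Λ] N.1),
      Module.Projective Λ P ∧ SES i p ∧ GoodMap i
  obtain ⟨Z, hZ1, hZ⟩ := exists_zseq R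
    (fun N => by
      obtain ⟨M, P, _, _, _, _, i, p, hM, hS⟩ := N.2.syz
      exact ⟨⟨ModuleCat.of Λ M, hM⟩, ModuleCat.of Λ P, i, p, hS.proj, hS.toSES, hS.good hM.np⟩)
    (fun M => by
      obtain ⟨N, P, _, _, _, _, i, p, hN, hS⟩ := M.2.cosyz
      exact ⟨⟨ModuleCat.of Λ N, hN⟩, ModuleCat.of Λ P, i, p, hS.proj, hS.toSES, hS.good M.2.np⟩)
    ⟨ModuleCat.of Λ M, h⟩
  choose P i p hP hs hg using hZ
  have hrange : ∀ k, LinearMap.range (i k ∘ₗ p (k + 1)) = LinearMap.range (i k) := fun k =>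
    LinearMap.range_comp_of_range_eq_top _ (LinearMap.range_eq_top.2 (hs (k + 1)).surj)
  refine ⟨P, fun k => i k ∘ₗ p (k + 1), hP, fun k => ?_, fun k φ hφ => ?_, ?_⟩
  · intro x
    constructor
    · intro hx
      have h1 : p (k + 1) x = 0 := (hs k).inj (by rw [map_zero]; exact hx)
      obtain ⟨m, rfl⟩ := ((hs (k + 1)).exact x).1 h1
      obtain ⟨y, rfl⟩ := (hs (k + 1 + 1)).surj m
      exact ⟨y, rfl⟩
    · rintro ⟨y, rfl⟩
      have := ((hs (k + 1)).exact (i (k + 1) (p (k + 1 + 1) y))).2 ⟨_, rfl⟩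
      simp only [LinearMap.comp_apply]
      rw [this, map_zero]
  · obtain ⟨g, hg'⟩ := aux_desc (p (k + 1)) (hs (k + 1)).surj φ (fun x hx => by
      obtain ⟨m, rfl⟩ := ((hs (k + 1)).exact x).1 hx
      obtain ⟨y, rfl⟩ := (hs (k + 1 + 1)).surj m
      exact LinearMap.congr_fun hφ y)
    obtain ⟨ψ, hψ⟩ := hg k g
    refine ⟨ψ, LinearMap.ext fun x => ?_⟩
    simp only [LinearMap.comp_apply]
    rw [hψ, hg']
  · have e1 : M ≃ₗ[Λ] (Z 1).1 := by rw [hZ1]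
    have e2 : (Z 1).1 ≃ₗ[Λ] LinearMap.range (i 0) := LinearEquiv.ofInjective (i 0) (hs 0).inj
    exact ⟨e1 ≪≫ₗ e2 ≪≫ₗ LinearEquiv.ofEq _ _ (hrange 0).symm⟩

lemma gp_of_subsingleton (M : Type u) [AddCommGroup M] [Module Λ M] [Subsingleton M] :
    IsGorensteinProjective Λ M := by
  refine ⟨fun _ => ModuleCat.of Λ PUnit, fun _ => 0, fun _ => ?_, fun _ x => ?_, fun _ φ _ => ?_, ?_⟩
  · exact (inferInstance : Module.Projective Λ PUnit.{u+1})
  · constructor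
    · intro _; exact ⟨0, (Subsingleton.elim (α := PUnit.{u+1}) _ _)⟩
    · intro _; rfl
  · refine ⟨0, LinearMap.ext fun x => ?_⟩
    rw [show x = 0 from Subsingleton.elim (α := PUnit.{u+1}) _ _, map_zero, map_zero]
  · have : Subsingleton (LinearMap.range (0 : ModuleCat.of Λ PUnit.{u+1} →ₗ[Λ] ModuleCat.of Λ PUnit.{u+1})) :=
      ⟨fun a b => Subtype.ext (Subsingleton.elim (α := PUnit.{u+1}) _ _)⟩
    exact ⟨LinearEquiv.ofBijective 0 ⟨fun _ _ _ => Subsingleton.elim _ _, fun _ => ⟨0, Subsingleton.elim _ _⟩⟩⟩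

lemma IsGorensteinProjective.of_equiv {M N : Type u} [AddCommGroup M] [Module Λ M] [AddCommGroup N]
    [Module Λ N] (h : IsGorensteinProjective Λ M) (e : N ≃ₗ[Λ] M) : IsGorensteinProjective Λ N := by
  obtain ⟨P, d, h1, h2, h3, ⟨e'⟩⟩ := h
  exact ⟨P, d, h1, h2, h3, ⟨e ≪≫ₗ e'⟩⟩

lemma g0_of [hN : IsNakayama Λ] {X : Type u} [AddCommGroup X] [Module Λ X]
    (hfl : ∃ n, HasLength Λ X n) (hX : IsIndecomposableMod Λ X) (hnp : ¬ Module.Projective Λ X)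
    (hgp : IsGorensteinProjective Λ X) : G0 (Λ := Λ) X := by
  have := finite_of_hasLength hfl
  refine ⟨us_of_indec X hX, hnp, X, _, _, LinearMap.id, LinearMap.id, ?_, fun _ => rfl⟩
  obtain ⟨P, d, h1, h2, h3, h4⟩ := hgp
  exact ⟨P, d, h1, h2, h3, 0, h4⟩

lemma main_aux [hN : IsNakayama Λ] {X Y : Type u} [AddCommGroup X] [Module Λ X] [AddCommGroup Y]
    [Module Λ Y] (hX : G0 (Λ := Λ) X) (hY : G0 (Λ := Λ) Y) (f : X →ₗ[Λ] Y) (hf : f ≠ 0) :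
    IsGorensteinProjective Λ (LinearMap.ker f) ∧
    IsGorensteinProjective Λ (LinearMap.range f) ∧
    IsGorensteinProjective Λ (Y ⧸ LinearMap.range f) := by
  have := hN.artinian
  obtain ⟨x0, hx0⟩ : ∃ x, f x ≠ 0 := by
    by_contra hc; push Not at hc; exact hf (LinearMap.ext hc)
  have hrs : Function.Surjective f.rangeRestrict := f.surjective_rangeRestrict
  have hnt : Nontrivial (LinearMap.range f) :=
    ⟨⟨f.rangeRestrict x0, 0, fun h => hx0 (congrArg Subtype.val h)⟩⟩
  refine ⟨?_, ?_, ?_⟩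
  · rcases subsingleton_or_nontrivial (LinearMap.ker f) with hs | hk
    · exact gp_of_subsingleton _
    refine TT.gp ⟨hX.us.of_inj _ (LinearMap.ker f).injective_subtype, fun hp => hX.np
      (hX.us.proj_of_sub hp _ (LinearMap.ker f).injective_subtype), ?_, ⟨X, _, _, hX, Or.inr
        ⟨_, (LinearMap.ker f).injective_subtype⟩⟩⟩
    obtain ⟨MX, PX, _, _, _, _, iX, pX, hMX, hSX⟩ := hX.syz
    obtain ⟨MY, PY, _, _, _, _, iY, pY, hMY, hSY⟩ := hY.syz
    have hses := SES.of_ker (f.rangeRestrict ∘ₗ pX) (hrs.comp hSX.surj)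
    obtain ⟨g, hg⟩ := syzSurj hses hSY.toSES hSX.proj hSY.us (LinearMap.range f).subtype
      (Submodule.injective_subtype _)
    obtain ⟨k, hk⟩ := aux_lift (LinearMap.ker f).subtype (Submodule.injective_subtype _)
      (pX ∘ₗ (LinearMap.ker (f.rangeRestrict ∘ₗ pX)).subtype)
      (fun m => ⟨⟨pX m.1, congrArg Subtype.val m.2⟩, rfl⟩)
    refine ⟨MY, _, _, hMY, US.tc (hSX.us.of_inj _ hses.inj) g hg k ?_⟩
    intro y
    obtain ⟨x, hx⟩ := hSX.surj y.1
    refine ⟨⟨x, ?_⟩, ?_⟩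
    · rw [LinearMap.mem_ker]
      apply Subtype.ext
      change f (pX x) = 0
      rw [hx]; exact y.2
    · apply Submodule.injective_subtype
      rw [hk]; exact hx
  · refine TT.gp ⟨hX.us.of_surj _ hrs, fun hp => ?_, ⟨X, _, _, hX, Or.inl ⟨_, hrs⟩⟩,
      ⟨Y, _, _, hY, Or.inr ⟨_, Submodule.injective_subtype _⟩⟩⟩
    by_cases hi : Function.Injective f.rangeRestrict
    · exact hX.np (Module.Projective.of_equiv (LinearEquiv.ofBijective _ ⟨hi, hrs⟩).symm)
    · rw [injective_iff_map_eq_zero] at hi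
      push Not at hi
      obtain ⟨a, ha, ha0⟩ := hi
      exact hX.us.quot_nonproj _ hrs a ha0 ha hp
  · rcases subsingleton_or_nontrivial (Y ⧸ LinearMap.range f) with hs | hk
    · exact gp_of_subsingleton _
    have hqs := (LinearMap.range f).mkQ_surjective
    refine TT.gp ⟨hY.us.of_surj _ hqs, hY.us.quot_nonproj _ hqs (f x0) hx0 (by simp),
      ⟨Y, _, _, hY, Or.inl ⟨_, hqs⟩⟩, ?_⟩
    obtain ⟨NX, QX, _, _, _, _, iX, pX, hNX, hSX⟩ := hX.cosyz
    obtain ⟨NY, QY, _, _, _, _, iY, pY, hNY, hSY⟩ := hY.cosyz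
    have hses := SES.of_quot (iY ∘ₗ (LinearMap.range f).subtype)
      (hSY.inj.comp (Submodule.injective_subtype _))
    obtain ⟨g, hg⟩ := cosyzInj hSX.toSES hses (hSX.good hX.np) hSX.us hSY.us hSY.proj
      f.rangeRestrict hrs
    obtain ⟨k, hk⟩ := aux_desc _ hqs
      ((LinearMap.range (iY ∘ₗ (LinearMap.range f).subtype)).mkQ ∘ₗ iY) (fun a ha => by
        have ha' : a ∈ LinearMap.range f := by simpa using ha
        exact (hses.exact _).2 ⟨⟨a, ha'⟩, rfl⟩)
    refine ⟨NX, _, _, hNX, US.sc (hSY.us.of_surj _ hses.surj) g hg k ?_⟩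
    rw [injective_iff_map_eq_zero]
    intro y hy
    obtain ⟨y, rfl⟩ := hqs y
    rw [hk] at hy
    obtain ⟨m, hm⟩ := (hses.exact _).1 hy
    have : m.1 = y := hSY.inj hm
    rw [← this]
    simpa using m.2

end Aux

/-- For a Nakayama algebra without simple projectives: if `X` and `Y` are indecomposable
non-projective Gorenstein projective (finite length) modules and `f : X → Y` is a
homomorphism, then the kernel, image and cokernel of `f` are Gorenstein projective. -/
theorem kernel_image_cokernel_gorenstein_projective [IsNakayama Λ]
    (h0 : NoSimpleProjectives Λ)
    (X Y : Type u) [AddCommGroup X] [Module Λ X] [AddCommGroup Y] [Module Λ Y]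
    (hflX : ∃ n, HasLength Λ X n) (hflY : ∃ n, HasLength Λ Y n)
    (hX : IsIndecomposableMod Λ X) (hY : IsIndecomposableMod Λ Y)
    (hXnp : ¬ Module.Projective Λ X) (hYnp : ¬ Module.Projective Λ Y)
    (hXgp : IsGorensteinProjective Λ X) (hYgp : IsGorensteinProjective Λ Y)
    (f : X →ₗ[Λ] Y) :
    IsGorensteinProjective Λ (LinearMap.ker f) ∧
    IsGorensteinProjective Λ (LinearMap.range f) ∧
    IsGorensteinProjective Λ (Y ⧸ LinearMap.range f) := by

  have hX' := g0_of hflX hX hXnp hXgp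
  have hY' := g0_of hflY hY hYnp hYgp
  by_cases hf : f = 0
  · subst hf
    have hr : LinearMap.range (0 : X →ₗ[Λ] Y) = ⊥ := LinearMap.range_zero
    have hk : LinearMap.ker (0 : X →ₗ[Λ] Y) = ⊤ := LinearMap.ker_zero
    refine ⟨?_, ?_, ?_⟩
    · rw [hk]; exact hXgp.of_equiv Submodule.topEquiv
    · rw [hr]; exact gp_of_subsingleton _
    · exact hYgp.of_equiv (Submodule.quotEquivOfEqBot _ hr)
  · exact main_aux hX' hY' f hf
end

section
/- Distinct elementary Gorenstein projective modules over a Nakayama algebra are pairwise orthogonal bricks: every nonzero homomorphism between elementary modules is an isomorphism. -/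
universe u

variable (Λ : Type u) [Ring Λ]

namespace Bricks

section

variable {Λ}

instance instArt [IsNakayama Λ] : IsArtinianRing Λ := IsNakayama.artinian

theorem finite_of_hasLength {M : Type u} [AddCommGroup M] [Module Λ M]
    (h : ∃ n, HasLength Λ M n) : Module.Finite Λ M := by
  obtain ⟨n, c, h0, h1, hc⟩ := h
  have : IsFiniteLength Λ M := isFiniteLength_of_exists_compositionSeries
    ⟨⟨n, c, fun i => hc i⟩, h0, h1⟩
  have := (isFiniteLength_iff_isNoetherian_isArtinian.mp this).1
  infer_instance

theorem hasLength_of_finite [IsNakayama Λ] {M : Type u} [AddCommGroup M] [Module Λ M]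
    [Module.Finite Λ M] : ∃ n, HasLength Λ M n := by
  obtain ⟨s, h0, h1⟩ := exists_compositionSeries_of_isNoetherian_isArtinian Λ M
  exact ⟨s.length, s.toFun, h0, h1, fun i => s.step i⟩

variable {M N P Q G T X : Type u}
  [AddCommGroup M] [Module Λ M] [AddCommGroup N] [Module Λ N]
  [AddCommGroup P] [Module Λ P] [AddCommGroup Q] [Module Λ Q]
  [AddCommGroup G] [Module Λ G] [AddCommGroup T] [Module Λ T]
  [AddCommGroup X] [Module Λ X]

theorem Uni.of_injective (h : IsUniserialMod Λ M) (j : N →ₗ[Λ] M) (hj : Function.Injective j) :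
    IsUniserialMod Λ N := by
  intro A B
  rcases h (A.map j) (B.map j) with h | h
  · exact Or.inl ((Submodule.map_le_map_iff_of_injective hj A B).1 h)
  · exact Or.inr ((Submodule.map_le_map_iff_of_injective hj B A).1 h)

theorem Uni.of_surjective (h : IsUniserialMod Λ M) (p : M →ₗ[Λ] N)
    (hp : Function.Surjective p) : IsUniserialMod Λ N := by
  intro A B
  rcases h (A.comap p) (B.comap p) with h | h
  · exact Or.inl ((Submodule.comap_le_comap_iff_of_surjective hp).1 h)
  · exact Or.inr ((Submodule.comap_le_comap_iff_of_surjective hp).1 h)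

theorem Uni.inj_of_comp (h : IsUniserialMod Λ P) [Nontrivial G] (j : G →ₗ[Λ] P) (g : P →ₗ[Λ] T)
    (hgj : Function.Injective (g ∘ₗ j)) : Function.Injective g := by
  rw [← LinearMap.ker_eq_bot] at hgj ⊢
  rcases h (LinearMap.ker g) (LinearMap.range j) with h | h
  · rw [eq_bot_iff]
    intro x hx
    obtain ⟨y, rfl⟩ := h hx
    have : y ∈ LinearMap.ker (g ∘ₗ j) := hx
    rw [hgj, Submodule.mem_bot] at this
    simp [this]
  · exfalso
    obtain ⟨y, hy⟩ := exists_ne (0 : G)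
    have : y ∈ LinearMap.ker (g ∘ₗ j) := h ⟨y, rfl⟩
    rw [hgj, Submodule.mem_bot] at this
    exact hy this

theorem Uni.surj_of_comp (h : IsUniserialMod Λ P) [Nontrivial G] (p : P →ₗ[Λ] G) (g : T →ₗ[Λ] P)
    (hgj : Function.Surjective (p ∘ₗ g)) : Function.Surjective g := by
  rcases h (LinearMap.ker p) (LinearMap.range g) with h | h
  · intro x
    obtain ⟨y, hy⟩ := hgj (p x)
    have : x - g y ∈ LinearMap.ker p := by
      simp only [LinearMap.mem_ker, map_sub, sub_eq_zero]; exact hy.symm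
    obtain ⟨z, hz⟩ := h this
    exact ⟨z + y, by simp [hz]⟩
  · exfalso
    obtain ⟨y, hy⟩ := exists_ne (0 : G)
    obtain ⟨z, rfl⟩ := hgj y
    exact hy (h ⟨z, rfl⟩)

theorem Uni.indec (h : IsUniserialMod Λ M) [Nontrivial M] : IsIndecomposableMod Λ M := by
  refine ⟨inferInstance, fun A B hAB => ?_⟩
  rcases h A B with h | h
  · left; exact hAB.disjoint.eq_bot_of_le h
  · right; exact hAB.disjoint.symm.eq_bot_of_le h

theorem uniserial_of_indec [IsNakayama Λ] [Module.Finite Λ M] (h : IsIndecomposableMod Λ M) :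
    IsUniserialMod Λ M := IsNakayama.serial M hasLength_of_finite h

/-- induction principle for finite modules -/
theorem fin_ind [IsNakayama Λ]
    (C : ∀ (T : Type u) [AddCommGroup T] [Module Λ T], Prop)
    (h1 : ∀ (T : Type u) [AddCommGroup T] [Module Λ T], Module.Finite Λ T →
      IsUniserialMod Λ T → C T)
    (h2 : ∀ (T : Type u) [AddCommGroup T] [Module Λ T] (A B : Submodule Λ T),
      IsCompl A B → C A → C B → C T)
    (T : Type u) [AddCommGroup T] [Module Λ T] [Module.Finite Λ T] : C T := by
  have key : ∀ (n : ℕ∞) (T : Type u) [AddCommGroup T] [Module Λ T], Module.Finite Λ T →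
      Module.length Λ T = n → C T := by
    intro n
    induction n using WellFoundedLT.induction with
    | ind n ih =>
    intro T _ _ hT hn
    by_cases hu : IsUniserialMod Λ T
    · exact h1 T hT hu
    have hnt : Nontrivial T := by
      by_contra hs
      rw [not_nontrivial_iff_subsingleton] at hs
      exact hu fun A B => Or.inl (by intro x hx; rw [Subsingleton.elim x 0]; simp)
    have hi : ¬ IsIndecomposableMod Λ T := fun h => hu (uniserial_of_indec h)
    unfold IsIndecomposableMod at hi
    push Not at hi
    obtain ⟨A, B, hAB, hA, hB⟩ := hi hnt
    have hA' : A ≠ ⊤ := fun h => hB (by subst h; simpa using hAB.inf_eq_bot)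
    have hB' : B ≠ ⊤ := fun h => hA (by subst h; simpa using hAB.inf_eq_bot)
    exact h2 T A B hAB (ih _ (hn ▸ Submodule.length_lt hA') A inferInstance rfl)
      (ih _ (hn ▸ Submodule.length_lt hB') B inferInstance rfl)
  exact key _ T inferInstance rfl

/-- complement decomposition as maps -/
theorem compl_maps (A B : Submodule Λ T) (h : IsCompl A B) :
    ∃ (p : T →ₗ[Λ] A) (q : T →ₗ[Λ] B), p ∘ₗ A.subtype = LinearMap.id ∧
      q ∘ₗ B.subtype = LinearMap.id ∧
      ∀ x, (p x : T) + (q x : T) = x := by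
  refine ⟨A.projectionOnto B h, B.projectionOnto A h.symm, ?_, ?_, ?_⟩
  · ext x; simp
  · ext x; simp
  · intro x
    exact Submodule.projection_add_projection_eq_self h x

/-- maps from finite modules to projectives factor through finite projectives -/
theorem factor_projective [Module.Finite Λ X]
    [Module.Projective Λ T] (g : X →ₗ[Λ] T) :
    ∃ (n : ℕ) (a : X →ₗ[Λ] (Fin n → Λ)) (b : (Fin n → Λ) →ₗ[Λ] T), b ∘ₗ a = g := by
  classical
  obtain ⟨s, hs⟩ := Module.projective_def'.1 (inferInstance : Module.Projective Λ T)
  obtain ⟨S, hS⟩ := (Module.Finite.fg_top : (⊤ : Submodule Λ X).FG)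
  let F : Finset T := S.biUnion fun x => (s (g x)).support
  have hF : ∀ x, s (g x) ∈ Finsupp.supported Λ Λ (F : Set T) := by
    intro x
    have : (⊤ : Submodule Λ X) ≤ (Finsupp.supported Λ Λ (F : Set T)).comap (s ∘ₗ g) := by
      rw [← hS, Submodule.span_le]
      intro x hx
      simp only [Submodule.comap_coe, Set.mem_preimage, SetLike.mem_coe, Finsupp.mem_supported]
      intro t ht
      simp only [F, Finset.coe_biUnion, Set.mem_iUnion]
      exact ⟨x, hx, ht⟩
    exact this (Submodule.mem_top (x := x))
  let e : (Finsupp.supported Λ Λ (F : Set T)) ≃ₗ[Λ] (Fin F.card → Λ) :=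
    (Finsupp.supportedEquivFinsupp (F : Set T)) ≪≫ₗ
      (Finsupp.linearEquivFunOnFinite Λ Λ (F : Set T)) ≪≫ₗ
      (LinearEquiv.funCongrLeft Λ Λ F.equivFin.symm)
  let g1 : X →ₗ[Λ] (Finsupp.supported Λ Λ (F : Set T)) := LinearMap.codRestrict _ (s ∘ₗ g) hF
  refine ⟨_, e.toLinearMap ∘ₗ g1,
    (Finsupp.linearCombination Λ id) ∘ₗ (Submodule.subtype _) ∘ₗ e.symm.toLinearMap, ?_⟩
  ext x
  have h2 := LinearMap.congr_fun hs (g x)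
  simp only [LinearMap.comp_apply, LinearEquiv.coe_coe, LinearEquiv.symm_apply_apply]
  exact h2

theorem ext_projective [Module.Finite Λ X] (j : X →ₗ[Λ] P)
    (H : ∀ (n : ℕ) (g : X →ₗ[Λ] (Fin n → Λ)), ∃ g' : P →ₗ[Λ] (Fin n → Λ), g' ∘ₗ j = g)
    [Module.Projective Λ T] (g : X →ₗ[Λ] T) : ∃ g' : P →ₗ[Λ] T, g' ∘ₗ j = g := by
  obtain ⟨n, a, b, rfl⟩ := factor_projective g
  obtain ⟨g', rfl⟩ := H n a
  exact ⟨b ∘ₗ g', rfl⟩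

theorem ext_pi (j : X →ₗ[Λ] P)
    (H : ∀ (g : X →ₗ[Λ] Λ), ∃ g' : P →ₗ[Λ] Λ, g' ∘ₗ j = g) (n : ℕ) (g : X →ₗ[Λ] (Fin n → Λ)) :
    ∃ g' : P →ₗ[Λ] (Fin n → Λ), g' ∘ₗ j = g := by
  choose g' hg' using fun i => H (LinearMap.proj i ∘ₗ g)
  refine ⟨LinearMap.pi g', ?_⟩
  ext x i
  exact LinearMap.congr_fun (hg' i) x

end

section

variable {Λ}

variable {M N P Q G T X Z : Type u}
  [AddCommGroup M] [Module Λ M] [AddCommGroup N] [Module Λ N]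
  [AddCommGroup P] [Module Λ P] [AddCommGroup Q] [Module Λ Q]
  [AddCommGroup G] [Module Λ G] [AddCommGroup T] [Module Λ T]
  [AddCommGroup X] [Module Λ X] [AddCommGroup Z] [Module Λ Z]

theorem compl_projective (A B : Submodule Λ T) (h : IsCompl A B) [Module.Projective Λ T] :
    Module.Projective Λ A ∧ Module.Projective Λ B := by
  obtain ⟨p, q, hp, hq, -⟩ := compl_maps A B h
  exact ⟨.of_split _ _ hp, .of_split _ _ hq⟩

theorem exists_cover [IsNakayama Λ] [Module.Finite Λ G] (hG : IsUniserialMod Λ G) :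
    ∃ (P : Type u) (_ : AddCommGroup P) (_ : Module Λ P) (π : P →ₗ[Λ] G),
      Module.Finite Λ P ∧ Module.Projective Λ P ∧ IsUniserialMod Λ P ∧ Function.Surjective π := by
  obtain ⟨n, f, hf⟩ := Module.Finite.exists_fin' Λ G
  have := fin_ind (Λ := Λ) (fun T _ _ => Module.Projective Λ T → ∀ π : T →ₗ[Λ] G,
    Function.Surjective π →
    ∃ (P : Type u) (_ : AddCommGroup P) (_ : Module Λ P) (π : P →ₗ[Λ] G),
      Module.Finite Λ P ∧ Module.Projective Λ P ∧ IsUniserialMod Λ P ∧ Function.Surjective π)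
    ?_ ?_ (Fin n → Λ)
  · exact this inferInstance f hf
  · intro T _ _ h1 h2 h3 π hπ
    exact ⟨T, _, _, π, h1, h3, h2, hπ⟩
  · intro T _ _ A B hAB hA hB hT π hπ
    obtain ⟨h1, h2⟩ := compl_projective A B hAB
    have hsup : A.map π ⊔ B.map π = ⊤ := by
      rw [← Submodule.map_sup, hAB.sup_eq_top, Submodule.map_top, LinearMap.range_eq_top]
      exact hπ
    have hr : ∀ C : Submodule Λ T, C.map π = ⊤ → Function.Surjective (π ∘ₗ C.subtype) := by
      intro C hC
      rw [← LinearMap.range_eq_top, LinearMap.range_comp, Submodule.range_subtype, hC]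
    rcases hG (A.map π) (B.map π) with h | h
    · exact hB h2 _ (hr B (by rwa [sup_eq_right.2 h] at hsup))
    · exact hA h1 _ (hr A (by rwa [sup_eq_left.2 h] at hsup))

theorem projective_of_sub [IsNakayama Λ] [Module.Finite Λ G] (hG : IsUniserialMod Λ G)
    [Module.Projective Λ N] [Nontrivial N] (n : N →ₗ[Λ] G) (hn : Function.Injective n) :
    Module.Projective Λ G := by
  obtain ⟨P, _, _, π, hf, hp, hu, hs⟩ := exists_cover hG
  obtain ⟨s, rfl⟩ := Module.projective_lifting_property π n hs
  have := Uni.inj_of_comp hu s π hn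
  exact Module.Projective.of_equiv (LinearEquiv.ofBijective π ⟨this, hs⟩)

theorem exists_embed [IsNakayama Λ] (hG : IsUniserialMod Λ G)
    [Module.Finite Λ T] [Module.Projective Λ T] (j : G →ₗ[Λ] T) (hj : Function.Injective j) :
    ∃ (P : Type u) (_ : AddCommGroup P) (_ : Module Λ P) (j : G →ₗ[Λ] P),
      Module.Finite Λ P ∧ Module.Projective Λ P ∧ IsUniserialMod Λ P ∧ Function.Injective j := by
  refine fin_ind (Λ := Λ) (fun T _ _ => Module.Projective Λ T → ∀ j : G →ₗ[Λ] T,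
    Function.Injective j →
    ∃ (P : Type u) (_ : AddCommGroup P) (_ : Module Λ P) (j : G →ₗ[Λ] P),
      Module.Finite Λ P ∧ Module.Projective Λ P ∧ IsUniserialMod Λ P ∧ Function.Injective j)
    ?_ ?_ T inferInstance j hj
  · intro T _ _ h1 h2 h3 π hπ
    exact ⟨T, _, _, π, h1, h3, h2, hπ⟩
  · intro T _ _ A B hAB hA hB hT j hj
    obtain ⟨h1, h2⟩ := compl_projective A B hAB
    obtain ⟨p, q, hp, hq, hpq⟩ := compl_maps A B hAB
    have hinf : ∀ x, p (j x) = 0 → q (j x) = 0 → x = 0 := by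
      intro x h1 h2
      apply hj
      rw [← hpq (j x), h1, h2]; simp
    rcases hG (LinearMap.ker (p ∘ₗ j)) (LinearMap.ker (q ∘ₗ j)) with h | h
    · refine hA h1 (p ∘ₗ j) ?_
      rw [← LinearMap.ker_eq_bot, eq_bot_iff]
      intro x hx
      exact hinf x hx (h hx)
    · refine hB h2 (q ∘ₗ j) ?_
      rw [← LinearMap.ker_eq_bot, eq_bot_iff]
      intro x hx
      exact hinf x (h hx) hx

variable (Λ) in
/-- minimal uniserial projective modules -/
structure IsPM (P : Type u) [AddCommGroup P] [Module Λ P] : Prop where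
  fin : Module.Finite Λ P
  proj : Module.Projective Λ P
  uni : IsUniserialMod Λ P
  nt : Nontrivial P
  min : ∀ N : Submodule Λ P, N ≠ ⊥ → Module.Projective Λ N → N = ⊤

theorem IsPM.ext_uni [IsNakayama Λ] (hP : IsPM Λ P) [Nontrivial Z] (j : Z →ₗ[Λ] P)
    (hj : Function.Injective j) [Module.Finite Λ T] [Module.Projective Λ T]
    (hT : IsUniserialMod Λ T) (g : Z →ₗ[Λ] T) : ∃ g' : P →ₗ[Λ] T, g' ∘ₗ j = g := by
  have := hP.fin
  by_cases hnt : Nontrivial T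
  swap
  · rw [not_nontrivial_iff_subsingleton] at hnt
    exact ⟨0, LinearMap.ext fun x => Subsingleton.elim _ _⟩
  let S : Set (Submodule Λ (P × T)) := {D | LinearMap.range (j.prod (-g)) ≤ D ∧
    ∀ t : T, ((0 : P), t) ∈ D → t = 0}
  have hS : S.Nonempty := by
    refine ⟨LinearMap.range (j.prod (-g)), le_rfl, ?_⟩
    rintro t ⟨z, hz⟩
    have h1 : j z = 0 := congrArg Prod.fst hz
    have h2 : -g z = t := congrArg Prod.snd hz
    have : z = 0 := hj (by simpa using h1)
    rw [← h2, this]; simp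
  obtain ⟨D, ⟨hD1, hD2⟩, hmax⟩ := (wellFounded_gt (α := Submodule Λ (P × T))).has_min S hS
  let ι : T →ₗ[Λ] ((P × T) ⧸ D) := D.mkQ ∘ₗ LinearMap.inr Λ P T
  let κ : P →ₗ[Λ] ((P × T) ⧸ D) := D.mkQ ∘ₗ LinearMap.inl Λ P T
  have hι : Function.Injective ι := by
    rw [← LinearMap.ker_eq_bot, eq_bot_iff]
    intro t ht
    have : D.mkQ ((0 : P), t) = 0 := ht
    rw [Submodule.mkQ_apply, Submodule.Quotient.mk_eq_zero] at this
    exact hD2 t this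
  have hκ : ∀ z, κ (j z) = ι (g z) := by
    intro z
    rw [← sub_eq_zero]
    change D.mkQ (j z, 0) - D.mkQ (0, g z) = 0
    rw [← map_sub, Submodule.mkQ_apply, Submodule.Quotient.mk_eq_zero]
    apply hD1
    exact ⟨z, by simp⟩
  have hess : ∀ W : Submodule Λ ((P × T) ⧸ D), W.comap ι = ⊥ → W = ⊥ := by
    intro W hW
    by_contra hne
    have hle : D ≤ W.comap D.mkQ := by
      intro x hx
      have : D.mkQ x = 0 := by simpa using hx
      rw [Submodule.mem_comap, this]
      exact W.zero_mem
    refine hmax (W.comap D.mkQ) ⟨hD1.trans hle, ?_⟩ ?_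
    · intro t ht
      have : t ∈ W.comap ι := ht
      rwa [hW, Submodule.mem_bot] at this
    · refine lt_of_le_of_ne hle ?_
      intro heq
      apply hne
      rw [eq_bot_iff]
      intro w hw
      obtain ⟨x, rfl⟩ := D.mkQ_surjective w
      have : x ∈ D := by rw [heq]; exact hw
      simpa using this
  have hV : IsUniserialMod Λ ((P × T) ⧸ D) := by
    apply uniserial_of_indec
    refine ⟨hι.nontrivial, fun A B hAB => ?_⟩
    have hb : A.comap ι ⊓ B.comap ι = ⊥ := by
      rw [← Submodule.comap_inf, hAB.inf_eq_bot]
      exact LinearMap.ker_eq_bot.2 hι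
    rcases hT (A.comap ι) (B.comap ι) with h | h
    · left; apply hess; rwa [inf_eq_left.2 h] at hb
    · right; apply hess; rwa [inf_eq_right.2 h] at hb
  have main : LinearMap.range κ ≤ LinearMap.range ι := by
    rcases hV (LinearMap.range κ) (LinearMap.range ι) with h | h
    · exact h
    · obtain ⟨s, hs⟩ := Module.projective_lifting_property κ.rangeRestrict
        (LinearMap.codRestrict (LinearMap.range κ) ι fun t => h ⟨t, rfl⟩)
        κ.surjective_rangeRestrict
      have hs' : ∀ t, κ (s t) = ι t := fun t => congrArg Subtype.val (LinearMap.congr_fun hs t)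
      have hsi : Function.Injective s := by
        intro a b hab
        apply hι
        rw [← hs', ← hs', hab]
      have htop := hP.min (LinearMap.range s) (by
        intro hbot
        obtain ⟨t, ht⟩ := exists_ne (0 : T)
        apply ht; apply hsi
        have : s t ∈ LinearMap.range s := ⟨t, rfl⟩
        rw [hbot, Submodule.mem_bot] at this
        rw [this, map_zero])
        (Module.Projective.of_equiv (LinearEquiv.ofInjective s hsi))
      rintro _ ⟨p, rfl⟩
      have : p ∈ LinearMap.range s := by rw [htop]; trivial
      obtain ⟨t, rfl⟩ := this
      exact ⟨t, (hs' t).symm⟩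
  refine ⟨(LinearEquiv.ofInjective ι hι).symm.toLinearMap ∘ₗ
    LinearMap.codRestrict (LinearMap.range ι) κ fun p => main ⟨p, rfl⟩, ?_⟩
  ext z
  apply (LinearEquiv.ofInjective ι hι).injective
  apply Subtype.ext
  simpa using hκ z

theorem IsPM.ext_fin [IsNakayama Λ] (hP : IsPM Λ P) [Nontrivial Z] (j : Z →ₗ[Λ] P)
    (hj : Function.Injective j) [Module.Finite Λ T] [Module.Projective Λ T]
    (g : Z →ₗ[Λ] T) : ∃ g' : P →ₗ[Λ] T, g' ∘ₗ j = g := by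
  refine fin_ind (Λ := Λ) (fun T _ _ => Module.Projective Λ T → ∀ g : Z →ₗ[Λ] T,
    ∃ g' : P →ₗ[Λ] T, g' ∘ₗ j = g) ?_ ?_ T inferInstance g
  · intro T _ _ h1 h2 h3 g
    exact hP.ext_uni j hj h2 g
  · intro T _ _ A B hAB hA hB hT g
    obtain ⟨h1, h2⟩ := compl_projective A B hAB
    obtain ⟨p, q, hp, hq, hpq⟩ := compl_maps A B hAB
    obtain ⟨a, ha⟩ := hA h1 (p ∘ₗ g)
    obtain ⟨b, hb⟩ := hB h2 (q ∘ₗ g)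
    refine ⟨A.subtype ∘ₗ a + B.subtype ∘ₗ b, ?_⟩
    ext z
    have e1 : a (j z) = p (g z) := LinearMap.congr_fun ha z
    have e2 : b (j z) = q (g z) := LinearMap.congr_fun hb z
    simp [e1, e2, hpq]

theorem IsPM.ext [IsNakayama Λ] (hP : IsPM Λ P) [Nontrivial Z] (j : Z →ₗ[Λ] P)
    (hj : Function.Injective j) [Module.Projective Λ T]
    (g : Z →ₗ[Λ] T) : ∃ g' : P →ₗ[Λ] T, g' ∘ₗ j = g := by
  have := hP.fin
  have : Module.Finite Λ Z := Module.Finite.of_injective j hj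
  exact ext_projective j (fun n g => hP.ext_fin j hj g) g

/-- shortest embedding -/
theorem exists_embed_min [IsNakayama Λ] [Module.Finite Λ G] [Nontrivial G]
    (hG : IsUniserialMod Λ G) (hGp : ¬ Module.Projective Λ G)
    [Module.Projective Λ T] (j : G →ₗ[Λ] T) (hj : Function.Injective j) :
    ∃ (P : Type u) (_ : AddCommGroup P) (_ : Module Λ P) (j : G →ₗ[Λ] P),
      IsPM Λ P ∧ Function.Injective j := by
  obtain ⟨n, a, b, rfl⟩ := factor_projective j
  have ha : Function.Injective a := Function.Injective.of_comp (f := b) hj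
  let S : Set ℕ∞ := {l | ∃ (P : Type u) (_ : AddCommGroup P) (_ : Module Λ P) (j : G →ₗ[Λ] P),
      Module.Finite Λ P ∧ Module.Projective Λ P ∧ IsUniserialMod Λ P ∧ Function.Injective j ∧
      Module.length Λ P = l}
  have hS : S.Nonempty := by
    obtain ⟨P, i1, i2, j, h1, h2, h3, h4⟩ := exists_embed hG a ha
    exact ⟨_, P, i1, i2, j, h1, h2, h3, h4, rfl⟩
  obtain ⟨l, ⟨P, i1, i2, j, h1, h2, h3, h4, rfl⟩, hmin⟩ := (wellFounded_lt (α := ℕ∞)).has_min S hS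
  refine ⟨P, i1, i2, j, ⟨h1, h2, h3, h4.nontrivial, ?_⟩, h4⟩
  intro N hN hNp
  rcases h3 N (LinearMap.range j) with h | h
  · exfalso
    apply hGp
    have : Nontrivial N := Submodule.nontrivial_iff_ne_bot.2 hN
    exact projective_of_sub hG ((LinearEquiv.ofInjective j h4).symm.toLinearMap ∘ₗ
      Submodule.inclusion h)
      ((LinearEquiv.ofInjective j h4).symm.injective.comp (Submodule.inclusion_injective h))
  · by_contra hne
    refine hmin (Module.length Λ N) ⟨N, _, _, j.codRestrict N fun x => h ⟨x, rfl⟩, inferInstance,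
      hNp, Uni.of_injective h3 N.subtype N.injective_subtype, ?_, rfl⟩ (Submodule.length_lt hne)
    intro x y hxy
    exact h4 (congrArg Subtype.val hxy)

end

section

variable {Λ}

variable {M N P Q G G' T X Z : Type u}
  [AddCommGroup M] [Module Λ M] [AddCommGroup N] [Module Λ N]
  [AddCommGroup P] [Module Λ P] [AddCommGroup Q] [Module Λ Q]
  [AddCommGroup G] [Module Λ G] [AddCommGroup G'] [Module Λ G'] [AddCommGroup T] [Module Λ T]
  [AddCommGroup X] [Module Λ X] [AddCommGroup Z] [Module Λ Z]

theorem ext_finproj (j : X →ₗ[Λ] P)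
    (H : ∀ (g : X →ₗ[Λ] Λ), ∃ g' : P →ₗ[Λ] Λ, g' ∘ₗ j = g)
    [Module.Finite Λ T] [Module.Projective Λ T] (g : X →ₗ[Λ] T) :
    ∃ g' : P →ₗ[Λ] T, g' ∘ₗ j = g := by
  obtain ⟨n, f, s, -, -, hfs⟩ := Module.Finite.exists_comp_eq_id_of_projective Λ T
  obtain ⟨g', hg'⟩ := ext_pi j H n (s ∘ₗ g)
  refine ⟨f ∘ₗ g', ?_⟩
  rw [LinearMap.comp_assoc, hg', ← LinearMap.comp_assoc, hfs, LinearMap.id_comp]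

theorem descend (p : P →ₗ[Λ] Q) (hp : Function.Surjective p) (f : P →ₗ[Λ] T)
    (h : ∀ x, p x = 0 → f x = 0) : ∃ f' : Q →ₗ[Λ] T, ∀ x, f' (p x) = f x := by
  refine ⟨(LinearMap.ker p).liftQ f (fun x hx => h x hx) ∘ₗ
    (p.quotKerEquivOfSurjective hp).symm.toLinearMap, fun x => ?_⟩
  have : (p.quotKerEquivOfSurjective hp).symm (p x) = (LinearMap.ker p).mkQ x := by
    rw [LinearEquiv.symm_apply_eq]; rfl
  rw [LinearMap.comp_apply, LinearEquiv.coe_coe, this]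
  rfl

variable (Λ) in
/-- complete projective resolutions -/
def IsComplete (P : ℤ → ModuleCat.{u} Λ) (d : ∀ i, P (i + 1) →ₗ[Λ] P i) : Prop :=
    (∀ i, Module.Projective Λ (P i)) ∧
    (∀ i, Function.Exact (d (i + 1)) (d i)) ∧
    (∀ (i : ℤ) (φ : P (i + 1) →ₗ[Λ] Λ), φ.comp (d (i + 1)) = 0 →
      ∃ ψ : P i →ₗ[Λ] Λ, ψ.comp (d i) = φ)

theorem IsComplete.ext {P : ℤ → ModuleCat.{u} Λ} {d : ∀ i, P (i + 1) →ₗ[Λ] P i}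
    (h : IsComplete Λ P d) (k : ℤ) (g : LinearMap.range (d k) →ₗ[Λ] Λ) :
    ∃ g' : P k →ₗ[Λ] Λ, g' ∘ₗ (LinearMap.range (d k)).subtype = g := by
  obtain ⟨ψ, hψ⟩ := h.2.2 k (g ∘ₗ (d k).rangeRestrict) (by
    ext x
    have : (d k).rangeRestrict (d (k + 1) x) = 0 := by
      apply Subtype.ext
      exact (h.2.1 k (d (k + 1) x)).2 ⟨x, rfl⟩
    simp [this])
  refine ⟨ψ, ?_⟩
  ext ⟨_, x, rfl⟩
  exact LinearMap.congr_fun hψ x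

variable (Λ) in
/-- Uniserial nonprojective retracts of Gorenstein projectives. -/
structure IsG (G : Type u) [AddCommGroup G] [Module Λ G] : Prop where
  fin : Module.Finite Λ G
  nt : Nontrivial G
  uni : IsUniserialMod Λ G
  nproj : ¬ Module.Projective Λ G
  ret : ∃ (P : ℤ → ModuleCat.{u} Λ) (d : ∀ i, P (i + 1) →ₗ[Λ] P i), IsComplete Λ P d ∧
    ∃ (k : ℤ) (i : G →ₗ[Λ] LinearMap.range (d k)) (r : LinearMap.range (d k) →ₗ[Λ] G),
      Function.Bijective (r ∘ₗ i)

theorem IsG.congr (h : IsG Λ G) (e : G ≃ₗ[Λ] G') : IsG Λ G' := by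
  obtain ⟨h1, h2, h3, h4, P, d, hc, k, i, r, hb⟩ := h
  refine ⟨Module.Finite.equiv e, e.injective.nontrivial, Uni.of_injective h3 e.symm.toLinearMap
    e.symm.injective, fun h => h4 (Module.Projective.of_equiv e.symm), P, d, hc, k,
    i ∘ₗ e.symm.toLinearMap, e.toLinearMap ∘ₗ r, ?_⟩
  exact e.bijective.comp (hb.comp e.symm.bijective)

theorem eq_top_of_inj [IsNakayama Λ] [Module.Finite Λ P] (A : Submodule Λ P) (h : P →ₗ[Λ] A)
    (hh : Function.Injective h) : A = ⊤ := by
  have := IsArtinian.bijective_of_injective_endomorphism (A.subtype ∘ₗ h)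
    (A.injective_subtype.comp hh)
  rw [eq_top_iff]
  intro x _
  obtain ⟨y, rfl⟩ := this.2 x
  exact (h y).2

theorem IsG.syz [IsNakayama Λ] (h : IsG Λ G) :
    ∃ (P : Type u) (_ : AddCommGroup P) (_ : Module Λ P) (π : P →ₗ[Λ] G),
      IsPM Λ P ∧ Function.Surjective π ∧ IsG Λ (LinearMap.ker π) := by
  obtain ⟨h1, h2, h3, h4, C, d, hc, k, i, r, hb⟩ := h
  obtain ⟨P, i1, i2, π, p1, p2, p3, hπ⟩ := exists_cover h3
  have hCp := hc.1
  refine ⟨P, i1, i2, π, ?_⟩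
  obtain ⟨a, ha⟩ := Module.projective_lifting_property (d k).rangeRestrict (i ∘ₗ π)
    (d k).surjective_rangeRestrict
  obtain ⟨b, hb'⟩ := Module.projective_lifting_property π (r ∘ₗ (d k).rangeRestrict) hπ
  have ha' : ∀ x, (d k).rangeRestrict (a x) = i (π x) := LinearMap.congr_fun ha
  have hb'' : ∀ x, π (b x) = r ((d k).rangeRestrict x) := LinearMap.congr_fun hb'
  have hba : Function.Bijective (b ∘ₗ a) := by
    apply IsNoetherian.bijective_of_surjective_endomorphism
    apply Uni.surj_of_comp p3 π
    have : π ∘ₗ b ∘ₗ a = (r ∘ₗ i) ∘ₗ π := by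
      ext x; simp only [LinearMap.comp_apply, hb'', ha']
    rw [this]
    exact hb.2.comp hπ
  let K := LinearMap.ker π
  have haK : ∀ x : K, a x ∈ LinearMap.range (d (k + 1)) := by
    intro x
    refine (hc.2.1 k (a x)).1 ?_
    have := congrArg Subtype.val (ha' x)
    have hx : π (x : P) = 0 := x.2
    rw [hx, map_zero] at this
    exact this
  have hbK : ∀ y : LinearMap.range (d (k + 1)), b y ∈ K := by
    intro y
    have hy : d k (y : C (k + 1)) = 0 := (hc.2.1 k y).2 y.2
    have : (d k).rangeRestrict (y : C (k + 1)) = 0 := Subtype.ext hy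
    rw [LinearMap.mem_ker, hb'', this, map_zero]
  let aK : K →ₗ[Λ] LinearMap.range (d (k + 1)) := LinearMap.codRestrict _ (a ∘ₗ K.subtype) haK
  let bK : LinearMap.range (d (k + 1)) →ₗ[Λ] K :=
    LinearMap.codRestrict _ (b ∘ₗ (LinearMap.range (d (k + 1))).subtype) hbK
  have hbaK : Function.Bijective (bK ∘ₗ aK) := by
    apply IsArtinian.bijective_of_injective_endomorphism
    intro x y hxy
    apply Subtype.ext
    apply hba.1
    exact congrArg Subtype.val hxy
  have hKnt : Nontrivial K := by
    rw [Submodule.nontrivial_iff_ne_bot]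
    intro hbot
    exact h4 (Module.Projective.of_equiv
      (LinearEquiv.ofBijective π ⟨LinearMap.ker_eq_bot.1 hbot, hπ⟩))
  have hext : ∀ g : K →ₗ[Λ] Λ, ∃ g' : P →ₗ[Λ] Λ, g' ∘ₗ K.subtype = g := by
    intro g
    let e := LinearEquiv.ofBijective _ hbaK
    obtain ⟨ψ, hψ⟩ := hc.ext (k + 1) (g ∘ₗ e.symm.toLinearMap ∘ₗ bK)
    refine ⟨ψ ∘ₗ a, ?_⟩
    ext x
    have h1 := LinearMap.congr_fun hψ (aK x)
    have h2 : e.symm (bK (aK x)) = x := e.symm_apply_apply x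
    simp only [LinearMap.comp_apply, LinearEquiv.coe_coe, h2] at h1
    exact h1
  have hKN : ∀ A : Submodule Λ P, K ≤ A → Module.Projective Λ A → A = ⊤ := by
    intro A hA hAp
    obtain ⟨h, hh⟩ := ext_finproj K.subtype hext (Submodule.inclusion hA)
    apply eq_top_of_inj A h
    apply Uni.inj_of_comp p3 K.subtype
    rw [hh]
    exact Submodule.inclusion_injective hA
  have hKu : IsUniserialMod Λ K := Uni.of_injective p3 K.subtype K.injective_subtype
  have hKp : ¬ Module.Projective Λ K := by
    intro hp
    have := hKN K le_rfl hp
    obtain ⟨y, hy⟩ := exists_ne (0 : G)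
    obtain ⟨x, rfl⟩ := hπ y
    have : x ∈ K := by rw [this]; trivial
    exact hy this
  refine ⟨⟨p1, p2, p3, hπ.nontrivial, ?_⟩, hπ, ⟨inferInstance, hKnt, hKu, hKp, C, d, hc, k + 1,
    aK, bK, hbaK⟩⟩
  intro A hA hAp
  rcases p3 A K with h | h
  · have : Nontrivial A := Submodule.nontrivial_iff_ne_bot.2 hA
    exact absurd (projective_of_sub hKu (Submodule.inclusion h) (Submodule.inclusion_injective h))
      hKp
  · exact hKN A h hAp

theorem IsG.cosyz [IsNakayama Λ] (h : IsG Λ G) :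
    ∃ (Q : Type u) (_ : AddCommGroup Q) (_ : Module Λ Q) (j : G →ₗ[Λ] Q),
      IsPM Λ Q ∧ Function.Injective j ∧ IsG Λ (Q ⧸ LinearMap.range j) := by
  obtain ⟨h1, h2, h3, h4, C, d, hc, k, i, r, hb⟩ := h
  obtain ⟨m, rfl⟩ : ∃ m, k = m + 1 := ⟨k - 1, by ring⟩
  have hCp := hc.1
  have hi : Function.Injective i := Function.Injective.of_comp (f := r) hb.1
  obtain ⟨Q, i1, i2, j, hQ, hj⟩ := exists_embed_min h3 h4
    ((LinearMap.range (d (m + 1))).subtype ∘ₗ i) ((Submodule.injective_subtype _).comp hi)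
  have hQf := hQ.fin
  have hQp := hQ.proj
  refine ⟨Q, i1, i2, j, hQ, hj, ?_⟩
  obtain ⟨σ, hσ⟩ := hQ.ext j hj ((LinearMap.range (d (m + 1))).subtype ∘ₗ i)
  obtain ⟨ρ, hρ⟩ := ext_finproj _ (hc.ext (m + 1)) (j ∘ₗ r)
  have hσ' : ∀ x, σ (j x) = i x := LinearMap.congr_fun hσ
  have hρ' : ∀ x : LinearMap.range (d (m + 1)), ρ x = j (r x) := LinearMap.congr_fun hρ
  have hρσ : Function.Bijective (ρ ∘ₗ σ) := by
    apply IsArtinian.bijective_of_injective_endomorphism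
    apply Uni.inj_of_comp hQ.uni j
    have : (ρ ∘ₗ σ) ∘ₗ j = j ∘ₗ (r ∘ₗ i) := by
      ext x; simp only [LinearMap.comp_apply, hσ', hρ']
    rw [this]
    exact hj.comp hb.1
  have hne : LinearMap.range j ≠ ⊤ := fun h =>
    h4 (Module.Projective.of_equiv
      (LinearEquiv.ofBijective j ⟨hj, LinearMap.range_eq_top.1 h⟩).symm)
  have hnt : Nontrivial (Q ⧸ LinearMap.range j) := Submodule.Quotient.nontrivial_iff.2 hne
  refine ⟨inferInstance, hnt,
    Uni.of_surjective hQ.uni (LinearMap.range j).mkQ (Submodule.mkQ_surjective _), ?_, C, d, hc, m,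
    ?_⟩
  · intro hp
    obtain ⟨t, ht⟩ := Module.projective_lifting_property (LinearMap.range j).mkQ LinearMap.id
      (Submodule.mkQ_surjective _)
    have ht2 : Function.Surjective t := by
      apply Uni.surj_of_comp hQ.uni (LinearMap.range j).mkQ
      rw [ht]; exact Function.surjective_id
    obtain ⟨y, hy⟩ := exists_ne (0 : G)
    apply hy
    apply hj
    obtain ⟨z, hz⟩ := ht2 (j y)
    have h5 : (LinearMap.range j).mkQ (t z) = z := LinearMap.congr_fun ht z
    rw [hz] at h5
    have h6 : (LinearMap.range j).mkQ (j y) = 0 := by simp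
    rw [h6] at h5
    rw [← hz, ← h5, map_zero, map_zero]
  · obtain ⟨r', hr'⟩ := descend (d m).rangeRestrict (d m).surjective_rangeRestrict
      ((LinearMap.range j).mkQ ∘ₗ ρ) (by
        intro x hx
        have hx' : d m x = 0 := congrArg Subtype.val hx
        have hx2 : x ∈ LinearMap.range (d (m + 1)) := (hc.2.1 m x).1 hx'
        have := hρ' ⟨x, hx2⟩
        simp only at this
        simp [this])
    obtain ⟨i', hi'⟩ := descend (LinearMap.range j).mkQ (Submodule.mkQ_surjective _)
      ((d m).rangeRestrict ∘ₗ σ) (by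
        intro x hx
        have : x ∈ LinearMap.range j := by simpa using hx
        obtain ⟨y, rfl⟩ := this
        apply Subtype.ext
        simp only [LinearMap.comp_apply, hσ']
        exact (hc.2.1 m _).2 (i y).2)
    refine ⟨i', r', ?_⟩
    apply IsNoetherian.bijective_of_surjective_endomorphism
    intro y
    obtain ⟨x, rfl⟩ := Submodule.mkQ_surjective _ y
    obtain ⟨z, rfl⟩ := hρσ.2 x
    refine ⟨(LinearMap.range j).mkQ z, ?_⟩
    rw [LinearMap.comp_apply, hi', LinearMap.comp_apply, hr']
    rfl

end

section

variable {Λ}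

variable {M N P Q G G' T X Z : Type u}
  [AddCommGroup M] [Module Λ M] [AddCommGroup N] [Module Λ N]
  [AddCommGroup P] [Module Λ P] [AddCommGroup Q] [Module Λ Q]
  [AddCommGroup G] [Module Λ G] [AddCommGroup G'] [Module Λ G'] [AddCommGroup T] [Module Λ T]
  [AddCommGroup X] [Module Λ X] [AddCommGroup Z] [Module Λ Z]

variable (Λ) in
/-- the projective modules in minimal complete resolutions -/
def IsPP (P : Type u) [AddCommGroup P] [Module Λ P] : Prop :=
  IsPM Λ P ∧ ∃ (G : Type u) (_ : AddCommGroup G) (_ : Module Λ G) (π : P →ₗ[Λ] G),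
    IsG Λ G ∧ Function.Surjective π ∧ IsG Λ (LinearMap.ker π)

theorem IsG.syz' [IsNakayama Λ] (h : IsG Λ G) :
    ∃ (P : Type u) (_ : AddCommGroup P) (_ : Module Λ P) (π : P →ₗ[Λ] G),
      IsPP Λ P ∧ Function.Surjective π ∧ IsG Λ (LinearMap.ker π) := by
  obtain ⟨P, i1, i2, π, h1, h2, h3⟩ := h.syz
  exact ⟨P, i1, i2, π, ⟨h1, G, _, _, π, h, h2, h3⟩, h2, h3⟩

theorem IsG.cosyz' [IsNakayama Λ] (h : IsG Λ G) :
    ∃ (Q : Type u) (_ : AddCommGroup Q) (_ : Module Λ Q) (j : G →ₗ[Λ] Q),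
      IsPP Λ Q ∧ Function.Injective j ∧ IsG Λ (Q ⧸ LinearMap.range j) := by
  obtain ⟨Q, i1, i2, j, h1, h2, h3⟩ := h.cosyz
  refine ⟨Q, i1, i2, j, ⟨h1, _, _, _, (LinearMap.range j).mkQ, h3, Submodule.mkQ_surjective _, ?_⟩,
    h2, h3⟩
  rw [Submodule.ker_mkQ]
  exact h.congr (LinearEquiv.ofInjective j h2)

theorem IsPP.left [IsNakayama Λ] (h : IsPP Λ P) :
    ∃ (U : Type u) (_ : AddCommGroup U) (_ : Module Λ U)
      (V : Type u) (_ : AddCommGroup V) (_ : Module Λ V) (u : U →ₗ[Λ] P) (v : V →ₗ[Λ] U),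
      IsPP Λ U ∧ IsPP Λ V ∧ LinearMap.range v = LinearMap.ker u ∧ u ≠ 0 ∧
        LinearMap.ker u ≠ ⊥ := by
  obtain ⟨h1, G, _, _, π, hG, hπ, hK⟩ := h
  obtain ⟨U, i1, i2, u, hU, hu, hKu⟩ := hK.syz'
  obtain ⟨V, i3, i4, v, hV, hv, -⟩ := hKu.syz'
  have hker : LinearMap.ker ((LinearMap.ker π).subtype ∘ₗ u) = LinearMap.ker u := by
    rw [LinearMap.ker_comp, Submodule.ker_subtype]; rfl
  refine ⟨U, i1, i2, V, i3, i4, (LinearMap.ker π).subtype ∘ₗ u,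
    (LinearMap.ker u).subtype ∘ₗ v, hU, hV, ?_, ?_, ?_⟩
  · rw [hker, LinearMap.range_comp, LinearMap.range_eq_top.2 hv, Submodule.map_top,
      Submodule.range_subtype]
  · intro h0
    have := hK.nt
    obtain ⟨y, hy⟩ := exists_ne (0 : LinearMap.ker π)
    obtain ⟨x, rfl⟩ := hu y
    exact hy (Subtype.ext (LinearMap.congr_fun h0 x))
  · rw [hker]
    exact Submodule.nontrivial_iff_ne_bot.1 hKu.nt

theorem IsPP.right [IsNakayama Λ] (h : IsPP Λ P) :
    ∃ (U : Type u) (_ : AddCommGroup U) (_ : Module Λ U)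
      (V : Type u) (_ : AddCommGroup V) (_ : Module Λ V) (p : P →ₗ[Λ] U) (q : U →ₗ[Λ] V),
      IsPP Λ U ∧ IsPP Λ V ∧ LinearMap.range p = LinearMap.ker q ∧ p ≠ 0 ∧
        LinearMap.range p ≠ ⊤ := by
  obtain ⟨h1, G, _, _, π, hG, hπ, hK⟩ := h
  obtain ⟨U, i1, i2, j, hU, hj, hC⟩ := hG.cosyz'
  obtain ⟨V, i3, i4, j', hV, hj', -⟩ := hC.cosyz'
  have hr : LinearMap.range (j ∘ₗ π) = LinearMap.range j := by
    rw [LinearMap.range_comp, LinearMap.range_eq_top.2 hπ, Submodule.map_top]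
  refine ⟨U, i1, i2, V, i3, i4, j ∘ₗ π, j' ∘ₗ (LinearMap.range j).mkQ, hU, hV, ?_, ?_, ?_⟩
  · rw [hr, LinearMap.ker_comp, LinearMap.ker_eq_bot.2 hj']
    exact (Submodule.ker_mkQ _).symm
  · intro h0
    have := hG.nt
    obtain ⟨y, hy⟩ := exists_ne (0 : G)
    obtain ⟨x, rfl⟩ := hπ y
    apply hy; apply hj
    rw [map_zero]
    exact LinearMap.congr_fun h0 x
  · rw [hr]
    exact Submodule.Quotient.nontrivial_iff.1 hC.nt

theorem not_inj_surj (hP : IsPM Λ P) (hQ : IsPM Λ Q) (φ : P →ₗ[Λ] Q) (h0 : φ ≠ 0)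
    (hb : ¬ Function.Bijective φ) : LinearMap.ker φ ≠ ⊥ ∧ LinearMap.range φ ≠ ⊤ := by
  have := hP.proj
  have := hQ.proj
  have := hQ.nt
  constructor
  · intro h
    have hi := LinearMap.ker_eq_bot.1 h
    have := hQ.min (LinearMap.range φ) (fun h => h0 (LinearMap.range_eq_bot.1 h))
      (Module.Projective.of_equiv (LinearEquiv.ofInjective φ hi))
    exact hb ⟨hi, LinearMap.range_eq_top.1 this⟩
  · intro h
    have hs := LinearMap.range_eq_top.1 h
    obtain ⟨t, ht⟩ := φ.exists_rightInverse_of_surjective h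
    have ht2 : Function.Surjective t := by
      apply Uni.surj_of_comp hP.uni φ
      rw [ht]; exact Function.surjective_id
    refine hb ⟨?_, hs⟩
    intro x y hxy
    obtain ⟨a, rfl⟩ := ht2 x
    obtain ⟨b, rfl⟩ := ht2 y
    have e : ∀ z, φ (t z) = z := LinearMap.congr_fun ht
    rw [e, e] at hxy
    rw [hxy]

/-- lifting along a map containing the range -/
theorem lift_range [Module.Projective Λ P] (f : P →ₗ[Λ] T) (g : Q →ₗ[Λ] T)
    (h : LinearMap.range f ≤ LinearMap.range g) : ∃ s : P →ₗ[Λ] Q, ∀ x, g (s x) = f x := by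
  obtain ⟨s, hs⟩ := Module.projective_lifting_property g.rangeRestrict
    (LinearMap.codRestrict (LinearMap.range g) f fun x => h ⟨x, rfl⟩) g.surjective_rangeRestrict
  exact ⟨s, fun x => congrArg Subtype.val (LinearMap.congr_fun hs x)⟩

/-- extension along a noninjective map -/
theorem IsPM.ext' [IsNakayama Λ] (hP : IsPM Λ P) (j : Z →ₗ[Λ] P)
    (hj : j ≠ 0) [Module.Projective Λ T]
    (g : Z →ₗ[Λ] T) (h : LinearMap.ker j ≤ LinearMap.ker g) :
    ∃ g' : P →ₗ[Λ] T, ∀ x, g' (j x) = g x := by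
  obtain ⟨f, hf⟩ := descend j.rangeRestrict j.surjective_rangeRestrict g
    (fun x hx => h (congrArg Subtype.val hx))
  have : Nontrivial (LinearMap.range j) := by
    rw [Submodule.nontrivial_iff_ne_bot]
    exact fun h => hj (LinearMap.range_eq_bot.1 h)
  obtain ⟨g', hg'⟩ := hP.ext (LinearMap.range j).subtype (Submodule.injective_subtype _) f
  refine ⟨g', fun x => ?_⟩
  rw [← hf]
  exact LinearMap.congr_fun hg' (j.rangeRestrict x)

theorem step_down [IsNakayama Λ] (hP : IsPP Λ P) (hQ : IsPP Λ Q) (φ : P →ₗ[Λ] Q) (h0 : φ ≠ 0) :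
    ∃ (R : Type u) (_ : AddCommGroup R) (_ : Module Λ R) (ψ : R →ₗ[Λ] P), IsPP Λ R ∧
      LinearMap.range ψ = LinearMap.ker φ := by
  obtain ⟨U, i1, i2, V, i3, i4, u, v, hU, hV, huv, hu0, hku⟩ := hQ.left
  have := hP.1.proj
  have := hU.1.proj
  have := hV.1.proj
  have huv0 : ∀ x, u (v x) = 0 := fun x => by
    have : v x ∈ LinearMap.range v := ⟨x, rfl⟩
    rwa [huv] at this
  rcases hQ.1.uni (LinearMap.range u) (LinearMap.range φ) with h | h
  · obtain ⟨g, hg⟩ := lift_range u φ h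
    refine ⟨V, i3, i4, g ∘ₗ v, hV, le_antisymm ?_ ?_⟩
    · rintro _ ⟨x, rfl⟩
      simp [hg, huv0]
    · intro x hx
      rcases hP.1.uni (LinearMap.range g) (LinearMap.ker φ) with h' | h'
      · exact absurd (LinearMap.ext fun y => by rw [← hg]; exact h' ⟨y, rfl⟩) hu0
      · obtain ⟨y, rfl⟩ := h' hx
        have : y ∈ LinearMap.ker u := by
          rw [LinearMap.mem_ker, ← hg]; exact hx
        rw [← huv] at this
        obtain ⟨z, rfl⟩ := this
        exact ⟨z, rfl⟩
  · obtain ⟨s, hs⟩ := lift_range φ u h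
    have hle : LinearMap.ker u ≤ LinearMap.range s := by
      rcases hU.1.uni (LinearMap.range s) (LinearMap.ker u) with h' | h'
      · exact absurd (LinearMap.ext fun y => by rw [← hs]; exact h' ⟨y, rfl⟩) h0
      · exact h'
    obtain ⟨w, hw⟩ := lift_range v s (huv.trans_le hle)
    refine ⟨V, i3, i4, w, hV, le_antisymm ?_ ?_⟩
    · rintro _ ⟨x, rfl⟩
      rw [LinearMap.mem_ker, ← hs, hw, huv0]
    · intro x hx
      have : s x ∈ LinearMap.ker u := by rw [LinearMap.mem_ker, hs]; exact hx
      rw [← huv] at this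
      obtain ⟨z, hz⟩ := this
      have hxz : x - w z ∈ LinearMap.ker s := by
        rw [LinearMap.mem_ker, map_sub, hw, hz, sub_self]
      rcases hP.1.uni (LinearMap.ker s) (LinearMap.range w) with h' | h'
      · obtain ⟨y, hy⟩ := h' hxz
        exact ⟨y + z, by rw [map_add, hy, sub_add_cancel]⟩
      · exfalso
        apply hku
        rw [← huv, LinearMap.range_eq_bot]
        ext y
        rw [← hw]
        exact h' ⟨y, rfl⟩

theorem step_up [IsNakayama Λ] (hP : IsPP Λ P) (hQ : IsPP Λ Q) (φ : P →ₗ[Λ] Q) (h0 : φ ≠ 0) :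
    ∃ (R : Type u) (_ : AddCommGroup R) (_ : Module Λ R) (χ : Q →ₗ[Λ] R), IsPP Λ R ∧
      LinearMap.ker χ = LinearMap.range φ := by
  obtain ⟨U, i1, i2, V, i3, i4, p, q, hU, hV, hpq, hp0, hpt⟩ := hP.right
  have := hQ.1.proj
  have := hU.1.proj
  have := hV.1.proj
  have hpq0 : ∀ x, q (p x) = 0 := fun x => by
    have : p x ∈ LinearMap.range p := ⟨x, rfl⟩
    rwa [hpq] at this
  rcases hP.1.uni (LinearMap.ker p) (LinearMap.ker φ) with h | h
  · obtain ⟨t, ht⟩ := hU.1.ext' p hp0 φ h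
    have hle : LinearMap.ker t ≤ LinearMap.ker q := by
      rw [← hpq]
      rcases hU.1.uni (LinearMap.range p) (LinearMap.ker t) with h' | h'
      · exact absurd (LinearMap.ext fun y => by rw [← ht]; exact h' ⟨y, rfl⟩) h0
      · exact h'
    have ht0 : t ≠ 0 := by
      rintro rfl
      exact h0 (LinearMap.ext fun y => by rw [← ht]; rfl)
    obtain ⟨χ, hχ⟩ := hQ.1.ext' t ht0 q hle
    refine ⟨V, i3, i4, χ, hV, le_antisymm ?_ ?_⟩
    · intro x hx
      rcases hQ.1.uni (LinearMap.range t) (LinearMap.ker χ) with h' | h'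
      · exfalso
        apply hpt
        rw [hpq, LinearMap.ker_eq_top]
        ext y
        rw [← hχ]
        exact h' ⟨y, rfl⟩
      · obtain ⟨y, rfl⟩ := h' hx
        have : y ∈ LinearMap.ker q := by rw [LinearMap.mem_ker, ← hχ]; exact hx
        rw [← hpq] at this
        obtain ⟨z, rfl⟩ := this
        exact ⟨z, (ht z).symm⟩
    · rintro _ ⟨x, rfl⟩
      rw [LinearMap.mem_ker, ← ht, hχ, hpq0]
  · obtain ⟨t, ht⟩ := hQ.1.ext' φ h0 p h
    refine ⟨V, i3, i4, q ∘ₗ t, hV, le_antisymm ?_ ?_⟩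
    · intro x hx
      have : t x ∈ LinearMap.ker q := hx
      rw [← hpq] at this
      obtain ⟨z, hz⟩ := this
      have hxz : x - φ z ∈ LinearMap.ker t := by
        rw [LinearMap.mem_ker, map_sub, ht, hz, sub_self]
      rcases hQ.1.uni (LinearMap.range φ) (LinearMap.ker t) with h' | h'
      · exact absurd (LinearMap.ext fun y => by rw [← ht]; exact h' ⟨y, rfl⟩) hp0
      · obtain ⟨y, hy⟩ := h' hxz
        exact ⟨y + z, by rw [map_add, hy, sub_add_cancel]⟩
    · rintro _ ⟨x, rfl⟩
      rw [LinearMap.mem_ker, LinearMap.comp_apply, ht, hpq0]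

end

section

variable {Λ}

variable {M N P Q G G' T X Y Z : Type u}
  [AddCommGroup M] [Module Λ M] [AddCommGroup N] [Module Λ N]
  [AddCommGroup P] [Module Λ P] [AddCommGroup Q] [Module Λ Q]
  [AddCommGroup G] [Module Λ G] [AddCommGroup G'] [Module Λ G'] [AddCommGroup T] [Module Λ T]
  [AddCommGroup X] [Module Λ X] [AddCommGroup Y] [Module Λ Y] [AddCommGroup Z] [Module Λ Z]

variable (Λ) in
/-- images of maps between the projectives of minimal complete resolutions -/
def IsX (X : Type u) [AddCommGroup X] [Module Λ X] : Prop :=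
  ∃ (P : Type u) (_ : AddCommGroup P) (_ : Module Λ P)
    (Q : Type u) (_ : AddCommGroup Q) (_ : Module Λ Q) (s : P →ₗ[Λ] X) (j : X →ₗ[Λ] Q),
    IsPP Λ P ∧ IsPP Λ Q ∧ Function.Surjective s ∧ Function.Injective j ∧ j ∘ₗ s ≠ 0 ∧
      ¬ Function.Bijective (j ∘ₗ s)

variable (Λ) in
/-- one short exact sequence of a complete resolution -/
def Rel (X Y : ModuleCat.{u} Λ) : Prop :=
  ∃ (P : ModuleCat.{u} Λ) (i : X →ₗ[Λ] P) (p : P →ₗ[Λ] Y), Module.Projective Λ P ∧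
    Function.Injective i ∧ Function.Exact i p ∧ Function.Surjective p ∧
    ∀ φ : X →ₗ[Λ] Λ, ∃ ψ : P →ₗ[Λ] Λ, ψ ∘ₗ i = φ

theorem isX_range (hP : IsPP Λ P) (hQ : IsPP Λ Q) (φ : P →ₗ[Λ] Q) (h0 : φ ≠ 0)
    (hb : ¬ Function.Bijective φ) : IsX Λ (LinearMap.range φ) :=
  ⟨P, _, _, Q, _, _, φ.rangeRestrict, (LinearMap.range φ).subtype, hP, hQ,
    φ.surjective_rangeRestrict, Submodule.injective_subtype _, h0, hb⟩

theorem IsX.nt (h : IsX Λ X) : Nontrivial X := by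
  obtain ⟨P, _, _, Q, _, _, s, j, -, -, -, -, h0, -⟩ := h
  by_contra hn
  rw [not_nontrivial_iff_subsingleton] at hn
  exact h0 (LinearMap.ext fun x => by
    rw [LinearMap.comp_apply, Subsingleton.elim (s x) 0, map_zero]; rfl)

theorem IsX.up [IsNakayama Λ] (h : IsX Λ X) :
    ∃ Y : ModuleCat.{u} Λ, IsX Λ Y ∧ Rel Λ (ModuleCat.of Λ X) Y := by
  have hX := h.nt
  obtain ⟨P, _, _, Q, _, _, s, j, hP, hQ, hs, hj, h0, hb⟩ := h
  obtain ⟨R, _, _, χ, hR, hχ⟩ := step_up hP hQ _ h0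
  obtain ⟨n1, n2⟩ := not_inj_surj hP.1 hQ.1 _ h0 hb
  have hr : LinearMap.range (j ∘ₗ s) = LinearMap.range j := by
    rw [LinearMap.range_comp, LinearMap.range_eq_top.2 hs, Submodule.map_top]
  refine ⟨ModuleCat.of Λ (LinearMap.range χ), isX_range hQ hR χ ?_ ?_, ModuleCat.of Λ Q, j,
    χ.rangeRestrict, hQ.1.proj, hj, ?_, χ.surjective_rangeRestrict, ?_⟩
  · intro h
    exact n2 (hχ ▸ LinearMap.ker_eq_top.2 h)
  · intro h
    have := LinearMap.ker_eq_bot.2 h.1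
    rw [hχ, LinearMap.range_eq_bot] at this
    exact h0 this
  · rw [LinearMap.exact_iff, LinearMap.ker_rangeRestrict, hχ, hr]
  · intro φ
    exact hQ.1.ext j hj φ

theorem IsX.down [IsNakayama Λ] (h : IsX Λ X) :
    ∃ W : ModuleCat.{u} Λ, IsX Λ W ∧ Rel Λ W (ModuleCat.of Λ X) := by
  obtain ⟨P, _, _, Q, _, _, s, j, hP, hQ, hs, hj, h0, hb⟩ := h
  obtain ⟨R, _, _, ψ, hR, hψ⟩ := step_down hP hQ _ h0
  obtain ⟨n1, n2⟩ := not_inj_surj hP.1 hQ.1 _ h0 hb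
  have hr : LinearMap.ker (j ∘ₗ s) = LinearMap.ker s := by
    rw [LinearMap.ker_comp, LinearMap.ker_eq_bot.2 hj]; rfl
  have hx : IsX Λ (LinearMap.range ψ) := by
    apply isX_range hR hP
    · intro h
      exact n1 (hψ ▸ LinearMap.range_eq_bot.2 h)
    · intro h
      have := LinearMap.range_eq_top.2 h.2
      rw [hψ, LinearMap.ker_eq_top] at this
      exact h0 this
  have hnt := hx.nt
  refine ⟨ModuleCat.of Λ (LinearMap.range ψ), hx, ModuleCat.of Λ P, (LinearMap.range ψ).subtype,
    s, hP.1.proj, Submodule.injective_subtype _, ?_, hs, ?_⟩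
  · rw [LinearMap.exact_iff]
    exact (hr.symm.trans hψ.symm).trans (Submodule.range_subtype _).symm
  · intro φ
    exact hP.1.ext (LinearMap.range ψ).subtype (Submodule.injective_subtype _) φ

theorem exists_zseq {α : Type*} (R : α → α → Prop) (h1 : ∀ a, ∃ b, R a b) (h2 : ∀ a, ∃ b, R b a)
    (a : α) : ∃ f : ℤ → α, f 1 = a ∧ ∀ n, R (f (n + 1)) (f n) := by
  choose g hg using h1
  choose h hh using h2
  let F : ℤ → α := fun n => Int.casesOn n (fun k => h^[k] a) (fun k => g^[k + 1] a)
  have hF : ∀ n, R (F (n + 1)) (F n) := by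
    intro n
    rcases n with k | k
    · have : F (Int.ofNat k + 1) = h (F (Int.ofNat k)) := by
        change h^[k + 1] a = h (h^[k] a)
        rw [Function.iterate_succ_apply']
      rw [this]; exact hh _
    · have : F (Int.negSucc k) = g (F (Int.negSucc k + 1)) := by
        cases k with
        | zero => rfl
        | succ k =>
          change g^[k + 1 + 1] a = g (g^[k + 1] a)
          rw [Function.iterate_succ_apply']
      rw [this]; exact hg _
  refine ⟨fun n => F (n - 1), rfl, fun n => ?_⟩
  have := hF (n - 1)
  rwa [show n - 1 + 1 = n + 1 - 1 by ring] at this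

theorem gp_congr (h : IsGorensteinProjective Λ M) (e : N ≃ₗ[Λ] M) :
    IsGorensteinProjective Λ N := by
  obtain ⟨P, d, a, b, c, ⟨e'⟩⟩ := h
  exact ⟨P, d, a, b, c, ⟨e.trans e'⟩⟩

theorem IsX.gp [IsNakayama Λ] (h : IsX Λ X) : IsGorensteinProjective Λ X := by
  obtain ⟨F, hF1, hF⟩ := exists_zseq (α := {X : ModuleCat.{u} Λ // IsX Λ X})
    (fun a b => Rel Λ a.1 b.1)
    (fun a => by
      obtain ⟨Y, hY, hr⟩ := IsX.up a.2
      exact ⟨⟨Y, hY⟩, hr⟩)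
    (fun a => by
      obtain ⟨Y, hY, hr⟩ := IsX.down a.2
      exact ⟨⟨Y, hY⟩, hr⟩) ⟨ModuleCat.of Λ X, h⟩
  choose P i p hP hi he hp hx using hF
  have key : IsGorensteinProjective Λ (F (0 + 1)).1 := by
    refine ⟨P, fun n => i n ∘ₗ p (n + 1), hP, fun n x => ?_, fun n φ hφ => ?_, ⟨?_⟩⟩
    · constructor
      · intro h
        have h' : p (n + 1) x = 0 := hi n (h.trans (map_zero _).symm)
        obtain ⟨y, rfl⟩ := (he (n + 1) x).1 h'
        obtain ⟨z, rfl⟩ := hp (n + 1 + 1) y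
        exact ⟨z, rfl⟩
      · rintro ⟨z, rfl⟩
        have : p (n + 1) (i (n + 1) (p (n + 1 + 1) z)) = 0 := (he (n + 1) _).2 ⟨_, rfl⟩
        change i n (p (n + 1) (i (n + 1) (p (n + 1 + 1) z))) = 0
        rw [this, map_zero]
    · obtain ⟨f', hf'⟩ := descend (p (n + 1)) (hp (n + 1)) φ (fun x hx0 => by
        obtain ⟨y, rfl⟩ := (he (n + 1) x).1 hx0
        obtain ⟨z, rfl⟩ := hp (n + 1 + 1) y
        exact LinearMap.congr_fun hφ z)
      obtain ⟨ψ, hψ⟩ := hx n f'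
      refine ⟨ψ, LinearMap.ext fun x => ?_⟩
      rw [← hf', ← hψ]; rfl
    · refine (LinearEquiv.ofInjective (i 0) (hi 0)).trans (LinearEquiv.ofEq _ _ ?_)
      exact ((LinearMap.range_comp _ _).trans (by
        rw [LinearMap.range_eq_top.2 (hp (0 + 1)), Submodule.map_top])).symm
  have e : F (0 + 1) = ⟨ModuleCat.of Λ X, h⟩ := hF1
  rw [e] at key
  exact key

theorem retract_nonproj [IsNakayama Λ] (T : Type u) [AddCommGroup T] [Module Λ T]
    [Module.Finite Λ T] : ¬ Module.Projective Λ T →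
    ∃ (A : Type u) (_ : AddCommGroup A) (_ : Module Λ A) (i : A →ₗ[Λ] T) (r : T →ₗ[Λ] A),
      IsUniserialMod Λ A ∧ ¬ Module.Projective Λ A ∧ r ∘ₗ i = LinearMap.id := by
  refine fin_ind (Λ := Λ) (fun T _ _ => ¬ Module.Projective Λ T →
    ∃ (A : Type u) (_ : AddCommGroup A) (_ : Module Λ A) (i : A →ₗ[Λ] T) (r : T →ₗ[Λ] A),
      IsUniserialMod Λ A ∧ ¬ Module.Projective Λ A ∧ r ∘ₗ i = LinearMap.id) ?_ ?_ T
  · intro T _ _ _ hu hn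
    exact ⟨T, _, _, LinearMap.id, LinearMap.id, hu, hn, rfl⟩
  · intro T _ _ A B hAB hA hB hn
    obtain ⟨p, q, hp, hq, -⟩ := compl_maps A B hAB
    by_cases h1 : Module.Projective Λ A
    · by_cases h2 : Module.Projective Λ B
      · exact absurd (Module.Projective.of_equiv (Submodule.prodEquivOfIsCompl A B hAB)) hn
      · obtain ⟨C, i1, i2, i, r, a, b, c⟩ := hB h2
        refine ⟨C, i1, i2, B.subtype ∘ₗ i, r ∘ₗ q, a, b, ?_⟩
        rw [LinearMap.comp_assoc, ← LinearMap.comp_assoc i B.subtype q, hq, LinearMap.id_comp, c]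
    · obtain ⟨C, i1, i2, i, r, a, b, c⟩ := hA h1
      refine ⟨C, i1, i2, A.subtype ∘ₗ i, r ∘ₗ p, a, b, ?_⟩
      rw [LinearMap.comp_assoc, ← LinearMap.comp_assoc i A.subtype p, hp, LinearMap.id_comp, c]

/-- image of a nonzero map is in the class -/
theorem isX_image [IsNakayama Λ] (hG : IsG Λ G) (hG' : IsG Λ G') (f : G →ₗ[Λ] G') (hf : f ≠ 0) :
    IsX Λ (LinearMap.range f) := by
  obtain ⟨P, _, _, π, hP, hπ, -⟩ := hG.syz'
  obtain ⟨Q, _, _, j, hQ, hj, -⟩ := hG'.cosyz'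
  refine ⟨P, _, _, Q, _, _, f.rangeRestrict ∘ₗ π, j ∘ₗ (LinearMap.range f).subtype, hP, hQ,
    f.surjective_rangeRestrict.comp hπ, hj.comp (Submodule.injective_subtype _), ?_, ?_⟩
  · intro h
    apply hf
    ext x
    obtain ⟨y, rfl⟩ := hπ x
    apply hj
    rw [LinearMap.zero_apply, map_zero]
    exact LinearMap.congr_fun h y
  · intro h
    have hs : Function.Surjective j := fun y => by
      obtain ⟨x, hx⟩ := h.2 y
      exact ⟨_, hx⟩
    have := hQ.1.proj
    exact hG'.nproj (Module.Projective.of_equiv (LinearEquiv.ofBijective j ⟨hj, hs⟩).symm)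

theorem IsG.gp [IsNakayama Λ] (hG : IsG Λ G) : IsGorensteinProjective Λ G := by
  have := hG.nt
  have h := isX_image hG hG LinearMap.id (by
    intro h
    obtain ⟨x, hx⟩ := exists_ne (0 : G)
    exact hx (LinearMap.congr_fun h x))
  exact gp_congr h.gp ((LinearEquiv.ofTop _ LinearMap.range_id).symm)

theorem ker_eq_bot_of (hE : IsElementary Λ M) (f : M →ₗ[Λ] T) (hf : f ≠ 0)
    (hg : IsGorensteinProjective Λ (LinearMap.range f)) : Function.Injective f := by
  by_contra h
  rw [← LinearMap.ker_eq_bot] at h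
  exact hE.2.2.2.2 (LinearMap.ker f) h (fun h => hf (LinearMap.ker_eq_top.1 h))
    (gp_congr hg f.quotKerEquivRange)

theorem elem_isG [IsNakayama Λ] (hE : IsElementary Λ M) : IsG Λ M := by
  have hfin := finite_of_hasLength hE.2.1
  obtain ⟨A, _, _, i, r, hu, hn, hri⟩ := retract_nonproj M hE.2.2.2.1
  have hs : Function.Surjective r := fun a => ⟨i a, LinearMap.congr_fun hri a⟩
  obtain ⟨P, d, a, b, c, ⟨e⟩⟩ := hE.2.2.1
  have hnt : Nontrivial A := by
    by_contra h
    rw [not_nontrivial_iff_subsingleton] at h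
    exact hn inferInstance
  have hA : IsG Λ A := by
    refine ⟨Module.Finite.of_surjective r hs, hnt, hu, hn, P, d, ⟨a, b, c⟩, 0,
      e.toLinearMap ∘ₗ i, r ∘ₗ e.symm.toLinearMap, ?_⟩
    have : (r ∘ₗ e.symm.toLinearMap) ∘ₗ (e.toLinearMap ∘ₗ i) = LinearMap.id := by
      ext x
      simpa using LinearMap.congr_fun hri x
    rw [this]; exact Function.bijective_id
  have hi : Function.Injective r := by
    refine ker_eq_bot_of hE r ?_ (gp_congr hA.gp (LinearEquiv.ofTop _ (LinearMap.range_eq_top.2 hs)))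
    rintro rfl
    obtain ⟨x, hx⟩ := exists_ne (0 : A)
    obtain ⟨y, hy⟩ := hs x
    exact hx (hy.symm.trans rfl)
  exact hA.congr (LinearEquiv.ofBijective r ⟨hi, hs⟩).symm

theorem gp_coker [IsNakayama Λ] (hG : IsG Λ G) (hG' : IsG Λ G') (f : G →ₗ[Λ] G') (hf : f ≠ 0)
    (ht : LinearMap.range f ≠ ⊤) : IsGorensteinProjective Λ (G' ⧸ LinearMap.range f) := by
  obtain ⟨P, _, _, π, hP, hπ, -⟩ := hG.syz'
  obtain ⟨P', _, _, π', hP', hπ', -⟩ := hG'.syz'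
  have := hP.1.proj
  obtain ⟨g, hg⟩ := lift_range (f ∘ₗ π) π' (by rw [LinearMap.range_eq_top.2 hπ']; exact le_top)
  have hle : LinearMap.ker π' ≤ LinearMap.range g := by
    rcases hP'.1.uni (LinearMap.range g) (LinearMap.ker π') with h | h
    · exfalso
      apply hf
      ext x
      obtain ⟨y, rfl⟩ := hπ x
      exact (hg y).symm.trans (h ⟨y, rfl⟩)
    · exact h
  have hker : LinearMap.ker ((LinearMap.range f).mkQ ∘ₗ π') = LinearMap.range g := by
    ext x
    rw [LinearMap.mem_ker, LinearMap.comp_apply, Submodule.mkQ_apply,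
      Submodule.Quotient.mk_eq_zero]
    constructor
    · rintro ⟨y, hy⟩
      obtain ⟨z, rfl⟩ := hπ y
      have : x - g z ∈ LinearMap.ker π' := by
        rw [LinearMap.mem_ker, map_sub, hg, ← hy]; exact sub_self _
      obtain ⟨w, hw⟩ := hle this
      exact ⟨w + z, by rw [map_add, hw, sub_add_cancel]⟩
    · rintro ⟨z, rfl⟩
      exact ⟨π z, (hg z).symm⟩
  have hs : Function.Surjective ((LinearMap.range f).mkQ ∘ₗ π') :=
    (Submodule.mkQ_surjective _).comp hπ'
  have hg0 : g ≠ 0 := by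
    rintro rfl
    apply hf
    ext x
    obtain ⟨y, rfl⟩ := hπ x
    exact (hg y).symm.trans (map_zero π')
  have hgt : LinearMap.range g ≠ ⊤ := by
    intro h
    apply ht
    rw [eq_top_iff]
    intro x _
    obtain ⟨y, rfl⟩ := hπ' x
    have : y ∈ LinearMap.range g := h ▸ trivial
    obtain ⟨z, rfl⟩ := this
    exact ⟨π z, (hg z).symm⟩
  obtain ⟨R, _, _, χ, hR, hχ⟩ := step_up hP hP' g hg0
  have hX : IsX Λ (LinearMap.range χ) := by
    apply isX_range hP' hR
    · intro h
      exact hgt (hχ ▸ LinearMap.ker_eq_top.2 h)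
    · intro h
      have := LinearMap.ker_eq_bot.2 h.1
      rw [hχ, LinearMap.range_eq_bot] at this
      exact hg0 this
  refine gp_congr hX.gp ?_
  exact ((LinearMap.quotKerEquivOfSurjective _ hs).symm.trans
    (Submodule.quotEquivOfEq _ _ (hker.trans hχ.symm))).trans χ.quotKerEquivRange

theorem main [IsNakayama Λ] (hE : IsElementary Λ M) (hE' : IsElementary Λ N)
    (f : M →ₗ[Λ] N) (hf : f ≠ 0) : Function.Bijective f := by
  have hM := elem_isG hE
  have hN := elem_isG hE'
  refine ⟨ker_eq_bot_of hE f hf (isX_image hM hN f hf).gp, ?_⟩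
  by_contra h
  rw [← LinearMap.range_eq_top] at h
  exact hE'.2.2.2.2 _ (fun h => hf (LinearMap.range_eq_bot.1 h)) h (gp_coker hM hN f hf h)

end

end Bricks

/-- Elementary Gorenstein projective modules over a Nakayama algebra without simple
projectives are pairwise orthogonal bricks: every nonzero homomorphism between elementary
modules is an isomorphism. -/
theorem elementary_are_orthogonal_bricks [IsNakayama Λ] (h0 : NoSimpleProjectives Λ)
    (E E' : Type u) [AddCommGroup E] [Module Λ E] [AddCommGroup E'] [Module Λ E']
    (hE : IsElementary Λ E) (hE' : IsElementary Λ E')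
    (f : E →ₗ[Λ] E') (hf : f ≠ 0) :
    Function.Bijective f := by
  exact Bricks.main hE hE' f hf
end
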